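/- arXiv:2603.05943 — 8 statements merged into one kernel-verified Lean document; each statement's English description precedes it below -/
import Mathlib

section
/- Let f = Σ_{i=0}^{m} X^i a_i be a monic polynomial in R = B[X;ρ,D] of degree m ≥ 1 (so a_m = 1). Then fR = Rf if and only if both of the following hold: (1) a_j ρ^m(α) = Σ_{i=j}^{m} Φ_{[i,j]}(α) a_i for every α ∈ B and every 0 ≤ j ≤ m−1; (2) D(a_i) = a_{i−1} − ρ(a_{i−1}) + a_i(ρ(a_{m−1}) − a_{m−1}) for 1 ≤ i ≤ m−1, and D(a_0) = a_0(ρ(a_{m−1}) − a_{m−1}). -/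
/-- The additive endomorphisms `Φ_{[i,j]}` of `B` determined by an automorphism `ρ`
and a `ρ`-derivation `D`:  `Φ_{[0,0]} = id`, `Φ_{[i,0]} = D^i`, `Φ_{[i,i]} = ρ^i`, and
`Φ_{[i,j]} = ρ ∘ Φ_{[i−1,j−1]} + D ∘ Φ_{[i−1,j]}` (with `Φ_{[i,j]} = 0` for `j > i`). -/
def Phi {B : Type*} [Ring B] (ρ D : B → B) : ℕ → ℕ → B → B
  | 0, 0 => id
  | 0, _ + 1 => fun _ => 0
  | i + 1, 0 => D ∘ Phi ρ D i 0
  | i + 1, j + 1 => fun α => ρ (Phi ρ D i j α) + D (Phi ρ D i (j + 1) α)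

section SkewPolynomial

variable {B R : Type*} [Ring B] [Ring R]

theorem Phi_eq_zero_of_lt (ρ : B ≃+* B) (D : B →+ B) (α : B) :
    ∀ {i j : ℕ}, i < j → Phi ρ D i j α = 0
  | 0, _ + 1, _ => rfl
  | i + 1, j + 1, h => by
    simp [Phi, Phi_eq_zero_of_lt ρ D α (show i < j by lia),
      Phi_eq_zero_of_lt ρ D α (show i < j + 1 by lia)]

theorem Phi_self (ρ : B ≃+* B) (D : B →+ B) (α : B) (i : ℕ) :
    Phi ρ D i i α = (ρ ^ i) α := by
  induction i with
  | zero => rfl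
  | succ i ih =>
    simp [Phi, ih, Phi_eq_zero_of_lt ρ D α (Nat.lt_succ_self i), pow_succ', RingAut.mul_apply]

variable (ι : B →+* R) (X : R)

/-- The additive map sending a coefficient sequence `c` to `∑ i, X ^ i * ι (c i)`. -/
noncomputable def skewSum : (ℕ →₀ B) →+ R :=
  Finsupp.liftAddHom fun i => (AddMonoidHom.mulLeft (X ^ i)).comp ι.toAddMonoidHom

theorem skewSum_apply (c : ℕ →₀ B) : skewSum ι X c = c.sum fun i b => X ^ i * ι b := rfl

theorem skewSum_single (i : ℕ) (b : B) : skewSum ι X (Finsupp.single i b) = X ^ i * ι b := by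
  simp [skewSum]

variable {ι X} (hfree : ∀ r : R, ∃! c : ℕ →₀ B, r = c.sum fun i b => X ^ i * ι b)

/-- The right coefficients of an element with respect to the basis of powers of `X`. -/
noncomputable def skewCoeff : R ≃+ (ℕ →₀ B) :=
  (AddEquiv.ofBijective (skewSum ι X)
    ⟨fun c d h => (hfree (skewSum ι X c)).unique rfl (h.trans (skewSum_apply ι X d)),
      fun r => (hfree r).exists.imp fun _ h => h.symm⟩).symm

theorem skewCoeff_monomial (i : ℕ) (b : B) :
    skewCoeff hfree (X ^ i * ι b) = Finsupp.single i b := by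
  rw [← skewSum_single]
  exact AddEquiv.symm_apply_apply (AddEquiv.ofBijective (skewSum ι X) _) _

include hfree in
theorem skew_induction {p : R → Prop} (hadd : ∀ r s, p r → p s → p (r + s))
    (hmon : ∀ i b, p (X ^ i * ι b)) (r : R) : p r := by
  obtain ⟨c, rfl⟩ := (hfree r).exists
  rw [← skewSum_apply]
  induction c using Finsupp.induction_linear with
  | zero => simpa using hmon 0 0
  | add c d hc hd => rw [map_add]; exact hadd _ _ hc hd
  | single i b => rw [skewSum_single]; exact hmon i b

theorem skewCoeff_map (b : B) : skewCoeff hfree (ι b) = Finsupp.single 0 b := by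
  simpa using skewCoeff_monomial hfree 0 b

theorem skewCoeff_mul_map (r : R) (b : B) (k : ℕ) :
    skewCoeff hfree (r * ι b) k = skewCoeff hfree r k * b := by
  induction r using skew_induction hfree with
  | hadd r s hr hs => simp [add_mul, hr, hs]
  | hmon i c =>
    rw [mul_assoc, ← map_mul, skewCoeff_monomial, skewCoeff_monomial]
    by_cases h : i = k <;> simp [h]

theorem skewCoeff_X_mul_zero (r : R) : skewCoeff hfree (X * r) 0 = 0 := by
  induction r using skew_induction hfree with
  | hadd r s hr hs => simp [mul_add, hr, hs]
  | hmon i c => rw [← mul_assoc, ← pow_succ', skewCoeff_monomial]; simp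

theorem skewCoeff_X_mul_succ (r : R) (k : ℕ) :
    skewCoeff hfree (X * r) (k + 1) = skewCoeff hfree r k := by
  induction r using skew_induction hfree with
  | hadd r s hr hs => simp [mul_add, hr, hs]
  | hmon i c =>
    rw [← mul_assoc, ← pow_succ', skewCoeff_monomial, skewCoeff_monomial]
    simp [Finsupp.single_apply]

variable {ρ : B ≃+* B} {D : B →+ B} (hcomm : ∀ α : B, ι α * X = X * ι (ρ α) + ι (D α))

include hcomm in
theorem monomial_mul_X (i : ℕ) (b : B) :
    X ^ i * ι b * X = X ^ (i + 1) * ι (ρ b) + X ^ i * ι (D b) := by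
  rw [mul_assoc, hcomm, mul_add, pow_succ, mul_assoc]

include hcomm in
theorem skewCoeff_mul_X_zero (r : R) :
    skewCoeff hfree (r * X) 0 = D (skewCoeff hfree r 0) := by
  induction r using skew_induction hfree with
  | hadd r s hr hs => simp [add_mul, hr, hs]
  | hmon i c =>
    rw [monomial_mul_X hcomm, map_add]
    simp only [skewCoeff_monomial]
    by_cases h : i = 0 <;> simp [h]

include hcomm in
theorem skewCoeff_mul_X_succ (r : R) (k : ℕ) :
    skewCoeff hfree (r * X) (k + 1) =
      ρ (skewCoeff hfree r k) + D (skewCoeff hfree r (k + 1)) := by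
  induction r using skew_induction hfree with
  | hadd r s hr hs => simp only [add_mul, map_add, Finsupp.add_apply, hr, hs]; abel
  | hmon i c =>
    rw [monomial_mul_X hcomm, map_add (skewCoeff hfree)]
    simp only [skewCoeff_monomial]
    by_cases h : i = k <;> by_cases h' : i = k + 1 <;> simp [h, h']

include hcomm in
theorem skewCoeff_map_mul_X_pow (α : B) (i j : ℕ) :
    skewCoeff hfree (ι α * X ^ i) j = Phi ρ D i j α := by
  induction i generalizing j with
  | zero => cases j <;> simp [skewCoeff_map, Phi]
  | succ i ih =>
    rw [pow_succ, ← mul_assoc]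
    cases j with
    | zero => rw [skewCoeff_mul_X_zero hfree hcomm, ih]; rfl
    | succ j => rw [skewCoeff_mul_X_succ hfree hcomm, ih, ih]; rfl

/-- `r` is monic of degree `m` for the right coefficients `skewCoeff`. -/
def SkewMonic (r : R) (m : ℕ) : Prop :=
  skewCoeff hfree r m = 1 ∧ ∀ k, m < k → skewCoeff hfree r k = 0

variable {hfree}

include hcomm in
theorem SkewMonic.mul_X {r : R} {m : ℕ} (h : SkewMonic hfree r m) :
    SkewMonic hfree (r * X) (m + 1) := by
  refine ⟨by simp [skewCoeff_mul_X_succ hfree hcomm, h.1, h.2], fun k hk => ?_⟩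
  obtain ⟨k, rfl⟩ : ∃ l, k = l + 1 := ⟨k - 1, by lia⟩
  simp [skewCoeff_mul_X_succ hfree hcomm, h.2 k (by lia), h.2 (k + 1) (by lia)]

include hcomm in
theorem SkewMonic.mul_X_pow {r : R} {m : ℕ} (h : SkewMonic hfree r m) (n : ℕ) :
    SkewMonic hfree (r * X ^ n) (m + n) := by
  induction n with
  | zero => simpa using h
  | succ n ih => rw [pow_succ, ← mul_assoc]; exact ih.mul_X hcomm

include hcomm in
/-- Left multiplication by a monic element of degree `m` raises degrees by exactly `m`. -/
theorem SkewMonic.coeff_eq_zero_of_mul {f s : R} {m d : ℕ}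
    (h : SkewMonic hfree f m) (hs : ∀ k, m + d < k → skewCoeff hfree (f * s) k = 0)
    (k : ℕ) (hk : d < k) : skewCoeff hfree s k = 0 := by
  obtain ⟨c, rfl⟩ := (hfree s).exists
  have hc : skewCoeff hfree (c.sum fun i b => X ^ i * ι b) = c :=
    (skewCoeff hfree).apply_symm_apply c
  rw [hc]
  by_contra hck
  have hmem : k ∈ c.support := Finsupp.mem_support_iff.2 hck
  set n := c.support.max' ⟨k, hmem⟩ with hn
  have hkn : k ≤ n := Finset.le_max' _ _ hmem
  have hnmem : n ∈ c.support := Finset.max'_mem _ _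
  refine Finsupp.mem_support_iff.1 hnmem ?_
  rw [← hs (m + n) (by lia), Finsupp.sum, Finset.mul_sum, map_sum, Finsupp.finsetSum_apply,
    Finset.sum_eq_single_of_mem n hnmem]
  · rw [← mul_assoc, skewCoeff_mul_map, (h.mul_X_pow hcomm n).1, one_mul]
  · intro i hi hin
    have hlt : i < n := lt_of_le_of_ne (Finset.le_max' _ _ hi) hin
    rw [← mul_assoc, skewCoeff_mul_map, (h.mul_X_pow hcomm i).2 _ (by lia), zero_mul]

variable (hfree)

theorem skewCoeff_sum_range (a : ℕ → B) (n k : ℕ) :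
    skewCoeff hfree (∑ i ∈ Finset.range n, X ^ i * ι (a i)) k = if k < n then a k else 0 := by
  simp [skewCoeff_monomial, Finsupp.finsetSum_apply, Finsupp.single_apply]

include hfree in
/-- An element with only a constant coefficient is that coefficient. -/
theorem eq_map_of_coeff_eq_zero {s : R} (h : ∀ k, 0 < k → skewCoeff hfree s k = 0) :
    s = ι (skewCoeff hfree s 0) := by
  apply (skewCoeff hfree).injective
  ext k
  rw [skewCoeff_map]
  rcases k with - | k
  · simp
  · simp [h (k + 1) (by lia)]

include hfree in
theorem eq_linear_of_coeff_eq_zero {s : R} (h : ∀ k, 1 < k → skewCoeff hfree s k = 0) :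
    s = X * ι (skewCoeff hfree s 1) + ι (skewCoeff hfree s 0) := by
  apply (skewCoeff hfree).injective
  ext k
  rcases k with - | - | k
  · simp [skewCoeff_map, skewCoeff_X_mul_zero]
  · simp [skewCoeff_map, skewCoeff_X_mul_succ]
  · simp [skewCoeff_map, skewCoeff_X_mul_succ, h (k + 2) (by lia)]

section Monic

variable {m : ℕ} {a : ℕ → B} {f : R} (ham : a m = 1)
  (hf : f = ∑ i ∈ Finset.range (m + 1), X ^ i * ι (a i))

include hf in
theorem skewCoeff_of_le {k : ℕ} (hk : k ≤ m) : skewCoeff hfree f k = a k := by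
  rw [hf, skewCoeff_sum_range, if_pos (by lia)]

include hf in
theorem skewCoeff_of_gt {k : ℕ} (hk : m < k) : skewCoeff hfree f k = 0 := by
  rw [hf, skewCoeff_sum_range, if_neg (by lia)]

include hcomm hf in
theorem skewCoeff_map_mul (α : B) (j : ℕ) :
    skewCoeff hfree (ι α * f) j = ∑ i ∈ Finset.Icc j m, Phi ρ D i j α * a i := by
  rw [hf, Finset.mul_sum, map_sum, Finsupp.finsetSum_apply]
  simp only [← mul_assoc, skewCoeff_mul_map, skewCoeff_map_mul_X_pow hfree hcomm]
  symm
  apply Finset.sum_subset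
  · intro i; simp only [Finset.mem_Icc, Finset.mem_range]; lia
  · intro i hi hi'
    simp only [Finset.mem_Icc, Finset.mem_range] at hi hi'
    rw [Phi_eq_zero_of_lt ρ D α (by lia), zero_mul]

include hfree hcomm ham hf in
theorem map_mul_eq_mul_map_iff (α : B) :
    ι α * f = f * ι ((ρ ^ m) α) ↔
      ∀ j < m, a j * (ρ ^ m) α = ∑ i ∈ Finset.Icc j m, Phi ρ D i j α * a i := by
  rw [← (skewCoeff hfree).injective.eq_iff, Finsupp.ext_iff]
  simp only [skewCoeff_map_mul hfree hcomm hf, skewCoeff_mul_map]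
  refine ⟨fun h j hj => ?_, fun h j => ?_⟩
  · rw [h j, skewCoeff_of_le hfree hf hj.le]
  · rcases lt_trichotomy j m with hj | rfl | hj
    · rw [← h j hj, skewCoeff_of_le hfree hf hj.le]
    · simp [skewCoeff_of_le hfree hf le_rfl, ham, Phi_self]
    · simp [skewCoeff_of_gt hfree hf hj, hj]

include hfree hcomm ham hf in
theorem mul_X_eq_iff (hD1 : D 1 = 0) (hm : 1 ≤ m) :
    f * X = X * f + f * ι (ρ (a (m - 1)) - a (m - 1)) ↔
      (∀ i, 1 ≤ i → i < m →
          D (a i) = a (i - 1) - ρ (a (i - 1)) + a i * (ρ (a (m - 1)) - a (m - 1))) ∧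
        D (a 0) = a 0 * (ρ (a (m - 1)) - a (m - 1)) := by
  rw [← (skewCoeff hfree).injective.eq_iff, Finsupp.ext_iff]
  simp only [map_add, Finsupp.add_apply, skewCoeff_mul_map]
  refine ⟨fun h => ⟨fun i hi him => ?_, ?_⟩, fun h j => ?_⟩
  · obtain ⟨k, rfl⟩ : ∃ k, i = k + 1 := ⟨i - 1, by lia⟩
    have := h (k + 1)
    rw [skewCoeff_mul_X_succ hfree hcomm, skewCoeff_X_mul_succ, skewCoeff_of_le hfree hf him.le,
      skewCoeff_of_le hfree hf (by lia)] at this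
    rw [Nat.add_sub_cancel, sub_add_eq_add_sub, ← this, add_sub_cancel_left]
  · have := h 0
    rwa [skewCoeff_mul_X_zero hfree hcomm, skewCoeff_X_mul_zero, zero_add,
      skewCoeff_of_le hfree hf (by lia)] at this
  · rcases j with - | k
    · rw [skewCoeff_mul_X_zero hfree hcomm, skewCoeff_X_mul_zero, zero_add,
        skewCoeff_of_le hfree hf (by lia), h.2]
    rw [skewCoeff_mul_X_succ hfree hcomm, skewCoeff_X_mul_succ]
    rcases lt_trichotomy (k + 1) m with hk | rfl | hk
    · rw [skewCoeff_of_le hfree hf hk.le, skewCoeff_of_le hfree hf (by lia),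
        h.1 (k + 1) (by lia) hk, Nat.add_sub_cancel]
      abel
    · simp [skewCoeff_of_le hfree hf, ham, hD1]
    · rw [skewCoeff_of_gt hfree hf hk]
      rcases (show m ≤ k by lia).eq_or_lt with rfl | hk'
      · simp [skewCoeff_of_le hfree hf, ham]
      · simp [skewCoeff_of_gt hfree hf hk']

include hfree hcomm ham hf in
theorem map_mul_eq_of_map_mul_eq_mul {α : B} {s : R} (hs : ι α * f = f * s) :
    ι α * f = f * ι ((ρ ^ m) α) := by
  have hmon : SkewMonic hfree f m :=
    ⟨(skewCoeff_of_le hfree hf le_rfl).trans ham, fun k hk => skewCoeff_of_gt hfree hf hk⟩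
  have hs0 := eq_map_of_coeff_eq_zero hfree (s := s) <|
    hmon.coeff_eq_zero_of_mul hcomm fun k hk => by
      simp [← hs, skewCoeff_map_mul hfree hcomm hf, show m < k by lia]
  have htop := congrArg (skewCoeff hfree · m) hs
  rw [hs0, skewCoeff_map_mul hfree hcomm hf, skewCoeff_mul_map, hmon.1] at htop
  simp only [Finset.Icc_self, Finset.sum_singleton, ham, mul_one, one_mul, Phi_self] at htop
  rw [htop, ← hs0, hs]

include hfree hcomm ham hf in
theorem mul_X_eq_of_X_mul_eq_mul (hD1 : D 1 = 0) (hm : 1 ≤ m) {s : R} (hs : X * f = f * s) :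
    f * X = X * f + f * ι (ρ (a (m - 1)) - a (m - 1)) := by
  have hmon : SkewMonic hfree f m :=
    ⟨(skewCoeff_of_le hfree hf le_rfl).trans ham, fun k hk => skewCoeff_of_gt hfree hf hk⟩
  have hlin := eq_linear_of_coeff_eq_zero hfree (s := s) <|
    hmon.coeff_eq_zero_of_mul hcomm fun k hk => by
      obtain ⟨l, rfl⟩ : ∃ l, k = l + 1 := ⟨k - 1, by lia⟩
      rw [← hs, skewCoeff_X_mul_succ, hmon.2 l (by lia)]
  generalize skewCoeff hfree s 1 = u at hlin
  generalize skewCoeff hfree s 0 = v at hlin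
  rw [hlin, mul_add, ← mul_assoc] at hs
  have hcoeff (k : ℕ) := congrArg (skewCoeff hfree · (k + 1)) hs
  simp only [map_add, Finsupp.add_apply, skewCoeff_mul_map, skewCoeff_X_mul_succ,
    skewCoeff_mul_X_succ hfree hcomm] at hcoeff
  have hu : u = 1 := by
    have := hcoeff m
    simpa [hmon.1, hmon.2, eq_comm] using this
  have hv : v = a (m - 1) - ρ (a (m - 1)) := by
    have := hcoeff (m - 1)
    rw [Nat.sub_add_cancel hm, hmon.1, skewCoeff_of_le hfree hf (Nat.sub_le m 1), hu, hD1] at this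
    exact eq_sub_of_add_eq' (by simpa using this.symm)
  rw [hs, hu, hv, map_one, mul_one, add_assoc, ← mul_add, ← map_add]
  simp

end Monic

include hfree in
/-- A subring containing `X` and the coefficients is everything. -/
theorem mem_subring_of_X_mem (S : Subring R) (hB : ∀ b, ι b ∈ S) (hX : X ∈ S) (r : R) : r ∈ S := by
  induction r using skew_induction hfree with
  | hadd r s hr hs => exact S.add_mem hr hs
  | hmon i b => exact S.mul_mem (S.pow_mem hX i) (hB b)

/-- The elements `r` with `r * f ∈ f * R`. -/
def leftIdealizer (f : R) : Subring R where
  carrier := {r | ∃ s, r * f = f * s}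
  mul_mem' := by
    rintro r r' ⟨s, hs⟩ ⟨s', hs'⟩
    exact ⟨s * s', by rw [mul_assoc, hs', ← mul_assoc, hs, mul_assoc]⟩
  one_mem' := ⟨1, by simp⟩
  add_mem' := by
    rintro r r' ⟨s, hs⟩ ⟨s', hs'⟩
    exact ⟨s + s', by rw [add_mul, hs, hs', mul_add]⟩
  zero_mem' := ⟨0, by simp⟩
  neg_mem' := by
    rintro r ⟨s, hs⟩
    exact ⟨-s, by rw [neg_mul, hs, mul_neg]⟩

/-- The elements `s` with `f * s ∈ R * f`. -/
def rightIdealizer (f : R) : Subring R where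
  carrier := {s | ∃ r, f * s = r * f}
  mul_mem' := by
    rintro s s' ⟨r, hr⟩ ⟨r', hr'⟩
    exact ⟨r * r', by rw [← mul_assoc, hr, mul_assoc, hr', mul_assoc]⟩
  one_mem' := ⟨1, by simp⟩
  add_mem' := by
    rintro s s' ⟨r, hr⟩ ⟨r', hr'⟩
    exact ⟨r + r', by rw [mul_add, hr, hr', add_mul]⟩
  zero_mem' := ⟨0, by simp⟩
  neg_mem' := by
    rintro s ⟨r, hr⟩
    exact ⟨-r, by rw [mul_neg, hr, neg_mul]⟩

end SkewPolynomial

/-- Let `f = Σ_{i=0}^{m} X^i a_i` be a monic polynomial of degree `m ≥ 1` in the skew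
polynomial ring `R = B[X;ρ,D]`.  Then `fR = Rf` if and only if
(1) `a_j ρ^m(α) = Σ_{i=j}^{m} Φ_{[i,j]}(α) a_i` for every `α ∈ B` and `0 ≤ j ≤ m−1`, and
(2) `D(a_i) = a_{i−1} − ρ(a_{i−1}) + a_i(ρ(a_{m−1}) − a_{m−1})` for `1 ≤ i ≤ m−1`,
and `D(a_0) = a_0(ρ(a_{m−1}) − a_{m−1})`. -/
theorem stmt1 {B R : Type*} [Ring B] [Ring R]
    (ι : B →+* R) (hι : Function.Injective ι) (X : R)
    (ρ : B ≃+* B) (D : B →+ B)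
    (hD : ∀ α β : B, D (α * β) = D α * ρ β + α * D β)
    (hcomm : ∀ α : B, ι α * X = X * ι (ρ α) + ι (D α))
    (hfree : ∀ r : R, ∃! c : ℕ →₀ B, r = c.sum fun i b => X ^ i * ι b)
    (m : ℕ) (hm : 1 ≤ m) (a : ℕ → B) (ham : a m = 1)
    (f : R) (hf : f = ∑ i ∈ Finset.range (m + 1), X ^ i * ι (a i)) :
    (Set.range fun r => f * r) = (Set.range fun r => r * f) ↔
      ((∀ α : B, ∀ j < m,
          a j * (ρ ^ m) α = ∑ i ∈ Finset.Icc j m, Phi (⇑ρ) (⇑D) i j α * a i) ∧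
        (∀ i, 1 ≤ i → i < m →
          D (a i) = a (i - 1) - ρ (a (i - 1)) + a i * (ρ (a (m - 1)) - a (m - 1))) ∧
        D (a 0) = a 0 * (ρ (a (m - 1)) - a (m - 1))) := by
  have hD1 : D 1 = 0 := by simpa using hD 1 1
  rw [← mul_X_eq_iff hfree hcomm ham hf hD1 hm]
  simp only [← map_mul_eq_mul_map_iff hfree hcomm ham hf]
  constructor
  · intro h
    have key (r : R) : ∃ s, r * f = f * s := by
      obtain ⟨s, hs⟩ := h.symm.subset ⟨r, rfl⟩
      exact ⟨s, hs.symm⟩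
    obtain ⟨s, hs⟩ := key X
    refine ⟨fun α => ?_, mul_X_eq_of_X_mul_eq_mul hfree hcomm ham hf hD1 hm hs⟩
    obtain ⟨t, ht⟩ := key (ι α)
    exact map_mul_eq_of_map_mul_eq_mul hfree hcomm ham hf ht
  · rintro ⟨hB, hX⟩
    have hB' (b : B) : f * ι b = ι ((ρ ^ m).symm b) * f := by
      rw [hB, RingEquiv.apply_symm_apply]
    apply Set.Subset.antisymm
    · rintro _ ⟨s, rfl⟩
      obtain ⟨r, hr⟩ := mem_subring_of_X_mem hfree (rightIdealizer f) (fun b => ⟨_, hB' b⟩)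
        ⟨X + ι ((ρ ^ m).symm (ρ (a (m - 1)) - a (m - 1))), by rw [hX, add_mul, hB']⟩ s
      exact ⟨r, hr.symm⟩
    · rintro _ ⟨r, rfl⟩
      obtain ⟨s, hs⟩ := mem_subring_of_X_mem hfree (leftIdealizer f) (fun b => ⟨_, hB b⟩)
        ⟨X - ι (ρ (a (m - 1)) - a (m - 1)), by rw [mul_sub, hX, add_sub_cancel_right]⟩ r
      exact ⟨s, hs.symm⟩
end

section
/- Let f = Σ_{i=0}^{m} X^i a_i be a monic polynomial of degree m ≥ 1 in R = B[X;ρ,D] with fR = Rf. If ρ(a_i) = a_i for all 0 ≤ i ≤ m−1, then every coefficient a_i (0 ≤ i ≤ m−1) lies in the center C(B^{ρ,D}) of the subring B^{ρ,D}; in particular D(a_i) = 0 for all i. -/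
namespace SkewPolynomial

variable {B R : Type*} [Ring B] [Ring R] {ι : B →+* R} {X : R}

/-- The additive subgroup of skew polynomials of degree less than `n`. -/
def degreeLT (ι : B →+* R) (X : R) (n : ℕ) : AddSubgroup R :=
  AddSubgroup.closure {r | ∃ i < n, ∃ b, r = X ^ i * ι b}

theorem monomial_mem_degreeLT {i n : ℕ} (h : i < n) (b : B) :
    X ^ i * ι b ∈ degreeLT ι X n :=
  AddSubgroup.subset_closure ⟨i, h, b, rfl⟩

theorem degreeLT_mono {m n : ℕ} (h : m ≤ n) : degreeLT ι X m ≤ degreeLT ι X n :=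
  AddSubgroup.closure_mono fun _ ⟨i, hi, b, hb⟩ => ⟨i, hi.trans_le h, b, hb⟩

theorem mul_coeff_mem_degreeLT {n : ℕ} {r : R} (hr : r ∈ degreeLT ι X n) (b : B) :
    r * ι b ∈ degreeLT ι X n := by
  induction hr using AddSubgroup.closure_induction with
  | mem x hx =>
    obtain ⟨i, hi, c, rfl⟩ := hx
    rw [mul_assoc, ← map_mul]
    exact monomial_mem_degreeLT hi _
  | zero => simp
  | add x y _ _ hx hy => simpa only [add_mul] using add_mem hx hy
  | neg x _ hx => simpa only [neg_mul] using neg_mem hx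

theorem mul_X_mem_degreeLT {ρ D : B → B}
    (hcomm : ∀ α : B, ι α * X = X * ι (ρ α) + ι (D α))
    {n : ℕ} {r : R} (hr : r ∈ degreeLT ι X n) : r * X ∈ degreeLT ι X (n + 1) := by
  induction hr using AddSubgroup.closure_induction with
  | mem x hx =>
    obtain ⟨i, hi, c, rfl⟩ := hx
    rw [mul_assoc, hcomm, mul_add, ← mul_assoc, ← pow_succ]
    exact add_mem (monomial_mem_degreeLT (by omega) _) (monomial_mem_degreeLT (by omega) _)
  | zero => simp
  | add x y _ _ hx hy => simpa only [add_mul] using add_mem hx hy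
  | neg x _ hx => simpa only [neg_mul] using neg_mem hx

theorem exists_eq_add_monomial {n : ℕ} {r : R} (hr : r ∈ degreeLT ι X (n + 1)) :
    ∃ t ∈ degreeLT ι X n, ∃ b, r = t + X ^ n * ι b := by
  induction hr using AddSubgroup.closure_induction with
  | mem x hx =>
    obtain ⟨i, hi, c, rfl⟩ := hx
    rcases Nat.lt_succ_iff_lt_or_eq.mp hi with h | rfl
    · exact ⟨_, monomial_mem_degreeLT h c, 0, by simp⟩
    · exact ⟨0, zero_mem _, c, by simp⟩
  | zero => exact ⟨0, zero_mem _, 0, by simp⟩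
  | add x y _ _ hx hy =>
    obtain ⟨t, ht, b, rfl⟩ := hx
    obtain ⟨u, hu, c, rfl⟩ := hy
    exact ⟨t + u, add_mem ht hu, b + c, by rw [map_add, mul_add]; abel⟩
  | neg x _ hx =>
    obtain ⟨t, ht, b, rfl⟩ := hx
    exact ⟨-t, neg_mem ht, -b, by rw [map_neg, mul_neg]; abel⟩

theorem exists_mem_degreeLT
    (hfree : ∀ r : R, ∃! c : ℕ →₀ B, r = c.sum fun i b => X ^ i * ι b) (r : R) :
    ∃ n, r ∈ degreeLT ι X n := by
  obtain ⟨c, rfl, -⟩ := hfree r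
  refine ⟨c.support.sup id + 1, sum_mem fun i hi => monomial_mem_degreeLT ?_ _⟩
  exact Nat.lt_succ_of_le (Finset.le_sup (f := id) hi)

/-- The coefficients with respect to the right basis `X ^ i` define an additive map. -/
theorem exists_coeff
    (hfree : ∀ r : R, ∃! c : ℕ →₀ B, r = c.sum fun i b => X ^ i * ι b) :
    ∃ coeff : R →+ (ℕ →₀ B), ∀ i b, coeff (X ^ i * ι b) = Finsupp.single i b := by
  choose c hc huniq using hfree
  refine ⟨AddMonoidHom.mk' c fun r s => (huniq _ _ ?_).symm, fun i b => (huniq _ _ ?_).symm⟩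
  · dsimp only
    rw [Finsupp.sum_add_index' (by simp) (by simp [mul_add]), ← hc r, ← hc s]
  · simp

theorem coeff_eq_zero_of_mem_degreeLT {coeff : R →+ (ℕ →₀ B)}
    (hcoeff : ∀ i b, coeff (X ^ i * ι b) = Finsupp.single i b)
    {n : ℕ} {r : R} (hr : r ∈ degreeLT ι X n) : coeff r n = 0 := by
  induction hr using AddSubgroup.closure_induction with
  | mem x hx =>
    obtain ⟨i, hi, c, rfl⟩ := hx
    rw [hcoeff, Finsupp.single_eq_of_ne hi.ne']
  | zero => simp
  | add x y _ _ hx hy => simp [hx, hy]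
  | neg x _ hx => simp [hx]

/-- A right multiple of a monic polynomial of degree `m` that has degree less than `m` is a
multiple by zero. -/
theorem eq_zero_of_monic_mul_mem_degreeLT {ρ D : B → B}
    (hcomm : ∀ α : B, ι α * X = X * ι (ρ α) + ι (D α))
    (hfree : ∀ r : R, ∃! c : ℕ →₀ B, r = c.sum fun i b => X ^ i * ι b)
    {m : ℕ} {f : R} (hf : f - X ^ m ∈ degreeLT ι X m) {s : R}
    (hs : f * s ∈ degreeLT ι X m) : s = 0 := by
  obtain ⟨coeff, hcoeff⟩ := exists_coeff hfree
  have hpow (k : ℕ) : f * X ^ k - X ^ (m + k) ∈ degreeLT ι X (m + k) := by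
    induction k with
    | zero => simpa using hf
    | succ k ih =>
      simpa only [sub_mul, mul_assoc, ← pow_succ, add_assoc] using mul_X_mem_degreeLT hcomm ih
  have hmon (k : ℕ) (b : B) :
      f * (X ^ k * ι b) - X ^ (m + k) * ι b ∈ degreeLT ι X (m + k) := by
    simpa only [sub_mul, mul_assoc] using mul_coeff_mem_degreeLT (hpow k) b
  have hmul {k : ℕ} {t : R} (ht : t ∈ degreeLT ι X k) : f * t ∈ degreeLT ι X (m + k) := by
    induction ht using AddSubgroup.closure_induction with
    | mem x hx =>
      obtain ⟨i, hi, c, rfl⟩ := hx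
      rw [← sub_add_cancel (f * (X ^ i * ι c)) (X ^ (m + i) * ι c)]
      exact add_mem (degreeLT_mono (by omega) (hmon i c)) (monomial_mem_degreeLT (by omega) _)
    | zero => simp
    | add x y _ _ hx hy => simpa only [mul_add] using add_mem hx hy
    | neg x _ hx => simpa only [mul_neg] using neg_mem hx
  obtain ⟨k, hk⟩ := exists_mem_degreeLT hfree s
  induction k with
  | zero => simpa [degreeLT] using hk
  | succ k ih =>
    obtain ⟨t, ht, b, rfl⟩ := exists_eq_add_monomial hk
    have hb : X ^ (m + k) * ι b ∈ degreeLT ι X (m + k) := by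
      have h := sub_mem (sub_mem (degreeLT_mono (Nat.le_add_right m k) hs) (hmul ht)) (hmon k b)
      convert h using 1
      rw [mul_add]
      abel
    have hb0 : b = 0 := by
      simpa [hcoeff] using coeff_eq_zero_of_mem_degreeLT hcoeff hb
    subst hb0
    exact ih (by simpa using ht)

theorem coeff_eq_zero_of_sum_eq_zero
    (hfree : ∀ r : R, ∃! c : ℕ →₀ B, r = c.sum fun i b => X ^ i * ι b)
    {m : ℕ} {c : ℕ → B} (h : ∑ i ∈ Finset.range m, X ^ i * ι (c i) = 0) :
    ∀ i < m, c i = 0 := by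
  obtain ⟨coeff, hcoeff⟩ := exists_coeff hfree
  intro i hi
  have h' := DFunLike.congr_fun (congrArg coeff h) i
  rw [map_sum, map_zero, Finsupp.finsetSum_apply] at h'
  simpa [hcoeff, Finsupp.single_apply, hi] using h'

/-- If a polynomial of degree less than `m` is a right multiple of a monic polynomial of
degree `m`, then all its coefficients vanish. -/
theorem coeff_eq_zero_of_sum_eq_monic_mul {ρ D : B → B}
    (hcomm : ∀ α : B, ι α * X = X * ι (ρ α) + ι (D α))
    (hfree : ∀ r : R, ∃! c : ℕ →₀ B, r = c.sum fun i b => X ^ i * ι b)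
    {m : ℕ} {f : R} (hf : f - X ^ m ∈ degreeLT ι X m) {c : ℕ → B} {s : R}
    (h : ∑ i ∈ Finset.range m, X ^ i * ι (c i) = f * s) : ∀ i < m, c i = 0 := by
  have hs : s = 0 := eq_zero_of_monic_mul_mem_degreeLT hcomm hfree hf <| h ▸
    sum_mem fun i hi => monomial_mem_degreeLT (Finset.mem_range.mp hi) _
  exact coeff_eq_zero_of_sum_eq_zero hfree (by rw [h, hs, mul_zero])

end SkewPolynomial

/-- Let `f = Σ_{i=0}^{m} X^i a_i` be a monic polynomial of degree `m ≥ 1` in the skew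
polynomial ring `R = B[X;ρ,D]` with `fR = Rf`.  If `ρ(a_i) = a_i` for all `0 ≤ i ≤ m−1`,
then every coefficient `a_i` (`0 ≤ i ≤ m−1`) lies in the center of the subring
`B^{ρ,D} = {β ∈ B : ρ(β) = β and D(β) = 0}`; in particular `D(a_i) = 0` for all `i`. -/
theorem stmt2 {B R : Type*} [Ring B] [Ring R]
    (ι : B →+* R) (hι : Function.Injective ι) (X : R)
    (ρ : B ≃+* B) (D : B →+ B)
    (hD : ∀ α β : B, D (α * β) = D α * ρ β + α * D β)
    (hcomm : ∀ α : B, ι α * X = X * ι (ρ α) + ι (D α))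
    (hfree : ∀ r : R, ∃! c : ℕ →₀ B, r = c.sum fun i b => X ^ i * ι b)
    (m : ℕ) (hm : 1 ≤ m) (a : ℕ → B) (ham : a m = 1)
    (f : R) (hf : f = ∑ i ∈ Finset.range (m + 1), X ^ i * ι (a i))
    (htwo : (Set.range fun r => f * r) = Set.range fun r => r * f)
    (hρa : ∀ i < m, ρ (a i) = a i) :
    ∀ i < m, D (a i) = 0 ∧
      ∀ β : B, ρ β = β → D β = 0 → a i * β = β * a i := by
  have hfm : f - X ^ m ∈ SkewPolynomial.degreeLT ι X m := by
    rw [hf, Finset.sum_range_succ, ham, map_one, mul_one, add_sub_cancel_right]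
    exact sum_mem fun i hi =>
      SkewPolynomial.monomial_mem_degreeLT (Finset.mem_range.mp hi) _
  have hleft (r : R) : ∃ s, f * s = r * f := by
    have h : r * f ∈ Set.range fun r => f * r := htwo ▸ ⟨r, rfl⟩
    exact h
  have hD1 : D 1 = 0 := by simpa using hD 1 1
  have hρ : ∀ i ∈ Finset.range (m + 1), ρ (a i) = a i := fun i hi => by
    rcases Nat.lt_succ_iff_lt_or_eq.mp (Finset.mem_range.mp hi) with h | rfl
    · exact hρa i h
    · rw [ham, map_one]
  have hDa : ∀ i < m, D (a i) = 0 := by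
    obtain ⟨s, hs⟩ := hleft X
    refine SkewPolynomial.coeff_eq_zero_of_sum_eq_monic_mul hcomm hfree hfm
      (c := fun i => D (a i)) (s := X - s) ?_
    have hfX : f * X = X * f + ∑ i ∈ Finset.range (m + 1), X ^ i * ι (D (a i)) := by
      rw [hf, Finset.sum_mul, Finset.mul_sum, ← Finset.sum_add_distrib]
      refine Finset.sum_congr rfl fun i hi => ?_
      rw [mul_assoc, hcomm, hρ i hi, mul_add, ← mul_assoc, ← mul_assoc, pow_mul_comm']
    rw [Finset.sum_range_succ, ham, hD1, map_zero, mul_zero, add_zero] at hfX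
    rw [mul_sub, hs, hfX, add_sub_cancel_left]
  refine fun i hi => ⟨hDa i hi, fun β hβ hDβ => ?_⟩
  have hβX : Commute (ι β) X := by
    simpa [commute_iff_eq, hβ, hDβ] using hcomm β
  obtain ⟨s, hs⟩ := hleft (ι β)
  refine sub_eq_zero.mp (SkewPolynomial.coeff_eq_zero_of_sum_eq_monic_mul hcomm hfree hfm
    (c := fun i => a i * β - β * a i) (s := ι β - s) ?_ i hi)
  have hfβ : f * (ι β - s) =
      ∑ i ∈ Finset.range (m + 1), X ^ i * ι (a i * β - β * a i) := by
    rw [mul_sub, hs, hf, Finset.sum_mul, Finset.mul_sum, ← Finset.sum_sub_distrib]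
    refine Finset.sum_congr rfl fun i _ => ?_
    rw [map_sub, map_mul, map_mul, mul_sub, ← mul_assoc, ← mul_assoc, ← mul_assoc,
      (hβX.pow_right i).eq]
  rw [hfβ, Finset.sum_range_succ, ham]
  simp
end

section
/- For any integer k and any u ∈ A_k, the element τ(u) commutes with x, i.e., x·τ(u) = τ(u)·x. -/
/-- The additive subgroup of right polynomials `Σ_{i < n} X^i b_i` of degree less than `n`. -/
def rightDegreeLT {B R : Type*} [Ring B] [Ring R] (ι : B →+* R) (X : R) (n : ℕ) :
    AddSubgroup R where
  carrier := {r | ∃ b : ℕ → B, r = ∑ i ∈ Finset.range n, X ^ i * ι (b i)}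
  zero_mem' := ⟨0, by simp⟩
  add_mem' := by
    rintro _ _ ⟨b, rfl⟩ ⟨c, rfl⟩
    exact ⟨b + c, by simp [mul_add, Finset.sum_add_distrib]⟩
  neg_mem' := by
    rintro _ ⟨b, rfl⟩
    exact ⟨-b, by simp⟩

section rightDegreeLT

variable {B R : Type*} [Ring B] [Ring R] {ι : B →+* R} {X : R}

theorem pow_mul_mem_rightDegreeLT {i n : ℕ} (h : i < n) (b : B) :
    X ^ i * ι b ∈ rightDegreeLT ι X n := by
  refine ⟨Pi.single i b, ?_⟩
  rw [Finset.sum_eq_single i]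
  · simp
  · intro j _ hj
    simp [hj]
  · simp [h]

theorem rightDegreeLT_mono {n k : ℕ} (h : n ≤ k) :
    rightDegreeLT ι X n ≤ rightDegreeLT ι X k := by
  rintro _ ⟨b, rfl⟩
  exact sum_mem fun i hi =>
    pow_mul_mem_rightDegreeLT ((Finset.mem_range.mp hi).trans_le h) (b i)

theorem mul_coeff_mem_rightDegreeLT {n : ℕ} {r : R} (hr : r ∈ rightDegreeLT ι X n) (c : B) :
    r * ι c ∈ rightDegreeLT ι X n := by
  obtain ⟨b, rfl⟩ := hr
  exact ⟨fun i => b i * c, by simp [Finset.sum_mul, mul_assoc]⟩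

theorem mul_X_mem_rightDegreeLT {ρ : B ≃+* B} {D : B →+ B}
    (hcomm : ∀ α : B, ι α * X = X * ι (ρ α) + ι (D α)) {n : ℕ} {r : R}
    (hr : r ∈ rightDegreeLT ι X n) : r * X ∈ rightDegreeLT ι X (n + 1) := by
  obtain ⟨b, rfl⟩ := hr
  rw [Finset.sum_mul]
  refine sum_mem fun i hi => ?_
  have hi := Finset.mem_range.mp hi
  rw [mul_assoc, hcomm, mul_add, ← mul_assoc, ← pow_succ]
  exact add_mem (pow_mul_mem_rightDegreeLT (by omega) _)
    (pow_mul_mem_rightDegreeLT (by omega) _)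

theorem coeff_eq_zero_of_sum_eq_zero
    (hfree : ∀ r : R, ∃! c : ℕ →₀ B, r = c.sum fun i b => X ^ i * ι b) {n : ℕ} {b : ℕ → B}
    (h : ∑ i ∈ Finset.range n, X ^ i * ι (b i) = 0) {i : ℕ} (hi : i < n) : b i = 0 := by
  classical
  let c : ℕ →₀ B := Finsupp.onFinset (Finset.range n)
    (fun j => if j < n then b j else 0) (by intro j; simp; tauto)
  have hc : (0 : R) = c.sum fun i b => X ^ i * ι b := by
    rw [Finsupp.onFinset_sum _ (by simp), ← h]
    exact Finset.sum_congr rfl fun j hj => by simp [Finset.mem_range.mp hj]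
  have h0 : c = 0 := (hfree 0).unique hc (by simp)
  simpa [c, hi] using DFunLike.congr_fun h0 i

theorem eq_zero_of_pow_mul_mem_rightDegreeLT
    (hfree : ∀ r : R, ∃! c : ℕ →₀ B, r = c.sum fun i b => X ^ i * ι b) {n : ℕ} {c : B}
    (h : X ^ n * ι c ∈ rightDegreeLT ι X n) : c = 0 := by
  obtain ⟨b, hb⟩ := h
  have hsum : ∑ i ∈ Finset.range (n + 1),
      X ^ i * ι ((fun j => if j < n then b j else -c) i) = 0 := by
    rw [Finset.sum_range_succ, Finset.sum_congr rfl (g := fun i => X ^ i * ι (b i))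
      (fun j hj => by simp [Finset.mem_range.mp hj]), ← hb]
    simp
  simpa using coeff_eq_zero_of_sum_eq_zero hfree hsum n.lt_succ_self

theorem monic_mul_pow_sub_mem_rightDegreeLT {ρ : B ≃+* B} {D : B →+ B}
    (hcomm : ∀ α : B, ι α * X = X * ι (ρ α) + ι (D α)) {m : ℕ} {f : R}
    (hf : f - X ^ m ∈ rightDegreeLT ι X m) (n : ℕ) :
    f * X ^ n - X ^ (m + n) ∈ rightDegreeLT ι X (m + n) := by
  induction n with
  | zero => simpa using hf
  | succ n ih =>
    have := mul_X_mem_rightDegreeLT hcomm ih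
    rwa [sub_mul, mul_assoc, ← pow_succ, ← pow_succ] at this

theorem monic_mul_mem_rightDegreeLT {ρ : B ≃+* B} {D : B →+ B}
    (hcomm : ∀ α : B, ι α * X = X * ι (ρ α) + ι (D α)) {m : ℕ} {f : R}
    (hf : f - X ^ m ∈ rightDegreeLT ι X m) {n : ℕ} {s : R} (hs : s ∈ rightDegreeLT ι X n) :
    f * s ∈ rightDegreeLT ι X (m + n) := by
  obtain ⟨c, rfl⟩ := hs
  rw [Finset.mul_sum]
  refine sum_mem fun i hi => ?_
  have hi := Finset.mem_range.mp hi
  rw [← mul_assoc]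
  refine mul_coeff_mem_rightDegreeLT ?_ _
  rw [← sub_add_cancel (f * X ^ i) (X ^ (m + i))]
  refine add_mem (rightDegreeLT_mono (by omega)
    (monic_mul_pow_sub_mem_rightDegreeLT hcomm hf i)) ?_
  simpa using pow_mul_mem_rightDegreeLT (ι := ι) (X := X) (show m + i < m + n by omega) 1

/-- A right multiple of a monic polynomial of degree `m` that has degree less than `m` is zero. -/
theorem eq_zero_of_monic_mul_mem_rightDegreeLT {ρ : B ≃+* B} {D : B →+ B}
    (hcomm : ∀ α : B, ι α * X = X * ι (ρ α) + ι (D α))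
    (hfree : ∀ r : R, ∃! c : ℕ →₀ B, r = c.sum fun i b => X ^ i * ι b) {m : ℕ} {f : R}
    (hf : f - X ^ m ∈ rightDegreeLT ι X m) {n : ℕ} {s : R} (hs : s ∈ rightDegreeLT ι X n)
    (hfs : f * s ∈ rightDegreeLT ι X m) : s = 0 := by
  induction n generalizing s with
  | zero =>
    obtain ⟨c, rfl⟩ := hs
    simp
  | succ n ih =>
    obtain ⟨c, rfl⟩ := hs
    rw [Finset.sum_range_succ] at hfs ⊢
    set t := ∑ i ∈ Finset.range n, X ^ i * ι (c i) with ht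
    have htmem : t ∈ rightDegreeLT ι X n := ⟨c, ht⟩
    have hlead : X ^ (m + n) * ι (c n) ∈ rightDegreeLT ι X (m + n) := by
      have := sub_mem (sub_mem (rightDegreeLT_mono (Nat.le_add_right m n) hfs)
        (monic_mul_mem_rightDegreeLT hcomm hf htmem))
        (mul_coeff_mem_rightDegreeLT (monic_mul_pow_sub_mem_rightDegreeLT hcomm hf n) (c n))
      convert this using 1
      noncomm_ring
    have hc := eq_zero_of_pow_mul_mem_rightDegreeLT hfree hlead
    simp only [hc, map_zero, mul_zero, add_zero] at hfs ⊢
    exact ih htmem hfs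

theorem exists_mem_rightDegreeLT
    (hfree : ∀ r : R, ∃! c : ℕ →₀ B, r = c.sum fun i b => X ^ i * ι b) (s : R) :
    ∃ n, s ∈ rightDegreeLT ι X n := by
  obtain ⟨c, hc, -⟩ := hfree s
  refine ⟨c.support.sup id + 1, ?_⟩
  rw [hc]
  exact sum_mem fun i hi =>
    pow_mul_mem_rightDegreeLT (Nat.lt_succ_of_le (Finset.le_sup (f := id) hi)) _

/-- The coefficients of a `ρ`-invariant monic polynomial `f` with `Rf ⊆ fR` are killed by `D`. -/
theorem derivation_coeff_eq_zero {ρ : B ≃+* B} {D : B →+ B} (hD1 : D 1 = 0)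
    (hcomm : ∀ α : B, ι α * X = X * ι (ρ α) + ι (D α))
    (hfree : ∀ r : R, ∃! c : ℕ →₀ B, r = c.sum fun i b => X ^ i * ι b)
    {m : ℕ} {a : ℕ → B} (ham : a m = 1) (hρa : ∀ i ≤ m, ρ (a i) = a i)
    {f : R} (hf : f = ∑ i ∈ Finset.range (m + 1), X ^ i * ι (a i))
    (hXf : ∃ r, f * r = X * f) {i : ℕ} (hi : i ≤ m) : D (a i) = 0 := by
  have hmonic : f - X ^ m ∈ rightDegreeLT ι X m :=
    ⟨a, by simp [hf, Finset.sum_range_succ, ham]⟩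
  obtain ⟨r, hr⟩ := hXf
  have hcommutator : f * (X - r) = ∑ i ∈ Finset.range m, X ^ i * ι (D (a i)) := by
    have hfX : f * X = X * f + ∑ i ∈ Finset.range (m + 1), X ^ i * ι (D (a i)) := by
      rw [hf, Finset.sum_mul, Finset.mul_sum, ← Finset.sum_add_distrib]
      refine Finset.sum_congr rfl fun j hj => ?_
      rw [mul_assoc, hcomm, hρa j (Nat.lt_succ_iff.mp (Finset.mem_range.mp hj)), mul_add,
        ← mul_assoc, ← mul_assoc, ← pow_succ, ← pow_succ']
    rw [mul_sub, hr, hfX, Finset.sum_range_succ, ham, hD1]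
    simp
  obtain ⟨n, hn⟩ := exists_mem_rightDegreeLT hfree (X - r)
  have hzero := eq_zero_of_monic_mul_mem_rightDegreeLT hcomm hfree hmonic hn
    ⟨fun i => D (a i), hcommutator⟩
  rw [hzero, mul_zero] at hcommutator
  rcases hi.lt_or_eq with hlt | rfl
  · exact coeff_eq_zero_of_sum_eq_zero (b := fun i => D (a i)) hfree hcommutator.symm hlt
  · rw [ham, hD1]

end rightDegreeLT


/-- In the setting of a monic `f = Σ_{i=0}^{m} X^i a_i` of degree `m ≥ 1` in `R = B[X;ρ,D]`
with all `a_i ∈ B^ρ` and `fR = Rf`, with `A = R/fR`, `x = X + fR`,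
`y_j = Σ_{k=j}^{m−1} x^{k−j} a_{k+1}` and `τ(z) = Σ_{j=0}^{m−1} y_j z x^j`:
for any integer `k` and any `u ∈ A_k = {u : αu = uρ^k(α) for all α ∈ B}`,
the element `τ(u)` commutes with `x`, i.e. `x·τ(u) = τ(u)·x`. -/
theorem stmt4 {B R A : Type*} [Ring B] [Ring R] [Ring A]
    (ι : B →+* R) (hι : Function.Injective ι) (X : R)
    (ρ : B ≃+* B) (D : B →+ B)
    (hD : ∀ α β : B, D (α * β) = D α * ρ β + α * D β)
    (hcomm : ∀ α : B, ι α * X = X * ι (ρ α) + ι (D α))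
    (hfree : ∀ r : R, ∃! c : ℕ →₀ B, r = c.sum fun i b => X ^ i * ι b)
    (m : ℕ) (hm : 1 ≤ m) (a : ℕ → B) (ham : a m = 1)
    (hρa : ∀ i ≤ m, ρ (a i) = a i)
    (f : R) (hf : f = ∑ i ∈ Finset.range (m + 1), X ^ i * ι (a i))
    (htwo : (Set.range fun r => f * r) = Set.range fun r => r * f)
    (π : R →+* A) (hπ : Function.Surjective π)
    (hker : ∀ r : R, π r = 0 ↔ ∃ s, r = f * s)
    (y : ℕ → A)
    (hy : ∀ j, y j = ∑ k ∈ Finset.Icc j (m - 1), π X ^ (k - j) * π (ι (a (k + 1))))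
    (τ : A → A)
    (hτ : ∀ z, τ z = ∑ j ∈ Finset.range m, y j * z * π X ^ j)
    (k : ℤ) (u : A)
    (hu : ∀ α : B, π (ι α) * u = u * π (ι ((ρ ^ k) α))) :
    π X * τ u = τ u * π X := by
  have hD1 : D 1 = 0 := by simpa using hD 1 1
  have hXf : ∃ r, f * r = X * f := by
    have : X * f ∈ Set.range fun r => f * r := htwo ▸ ⟨X, rfl⟩
    exact this
  have hcommute : ∀ i ≤ m, Commute (ι (a i)) X := fun i hi => by
    rw [Commute, SemiconjBy, hcomm, hρa i hi,
      derivation_coeff_eq_zero hD1 hcomm hfree ham hρa hf hXf hi, map_zero, add_zero]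
  have hρk : ∀ i ≤ m, (ρ ^ k) (a i) = a i := fun i hi =>
    (MulAction.stabilizer (B ≃+* B) (a i)).zpow_mem (hρa i hi) k
  have hfx : ∑ i ∈ Finset.range (m + 1), π X ^ i * π (ι (a i)) = 0 := by
    have : π f = 0 := (hker f).mpr ⟨1, (mul_one f).symm⟩
    simpa [hf] using this
  have hau : ∑ i ∈ Finset.range (m + 1), π (ι (a i)) * u * π X ^ i = 0 := by
    rw [← mul_zero u, ← hfx, Finset.mul_sum]
    refine Finset.sum_congr rfl fun i hi => ?_
    have hi := Nat.lt_succ_iff.mp (Finset.mem_range.mp hi)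
    rw [hu, hρk i hi, mul_assoc, (((hcommute i hi).map π).pow_right i).eq]
  obtain ⟨n, rfl⟩ : ∃ n, m = n + 1 := ⟨m - 1, by omega⟩
  have hxy : ∀ j < n, π X * y (j + 1) = y j - π (ι (a (j + 1))) := fun j hj => by
    rw [hy, hy, Nat.add_sub_cancel, ← Finset.add_sum_Ioc_eq_sum_Icc hj.le, Nat.sub_self, pow_zero,
      one_mul, add_sub_cancel_left, Finset.mul_sum]
    refine Finset.sum_congr (by ext; simp) fun i hi => ?_
    have := (Finset.mem_Ioc.mp hi).1
    rw [← mul_assoc, ← pow_succ', show i - (j + 1) + 1 = i - j by omega]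
  have hxy0 : π X * y 0 = -π (ι (a 0)) := by
    rw [eq_neg_iff_add_eq_zero, ← hfx, Finset.sum_range_succ' _ (n + 1), hy, Finset.mul_sum]
    congr 1
    · refine Finset.sum_congr (by ext; simp) fun i _ => ?_
      rw [← mul_assoc, ← pow_succ', Nat.sub_zero]
    · simp
  have hyn : y n = 1 := by simp [hy, ham]
  rw [hτ, Finset.mul_sum, Finset.sum_mul, Finset.sum_range_succ', Finset.sum_range_succ, hyn]
  rw [Finset.sum_range_succ, Finset.sum_range_succ', ham] at hau
  have hterm : ∑ j ∈ Finset.range n, π X * (y (j + 1) * u * π X ^ (j + 1)) =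
      ∑ j ∈ Finset.range n, y j * u * π X ^ j * π X -
        ∑ j ∈ Finset.range n, π (ι (a (j + 1))) * u * π X ^ (j + 1) := by
    rw [← Finset.sum_sub_distrib]
    refine Finset.sum_congr rfl fun j hj => ?_
    rw [← mul_assoc, ← mul_assoc, hxy j (Finset.mem_range.mp hj), sub_mul, sub_mul,
      pow_succ, ← mul_assoc]
  have hterm0 : π X * (y 0 * u * π X ^ 0) = -(π (ι (a 0)) * u * π X ^ 0) := by
    rw [← mul_assoc, ← mul_assoc, hxy0, neg_mul, neg_mul]
  have htop : 1 * u * π X ^ n * π X = π (ι 1) * u * π X ^ (n + 1) := by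
    rw [map_one, map_one, pow_succ, mul_assoc]
  rw [hterm, hterm0, htop, ← sub_eq_zero, ← neg_eq_zero, ← hau]
  abel
end

section
/- For any integer k, the inner derivation I_x maps A_k into the kernel of τ, i.e., τ(ux − xu) = 0 for every u ∈ A_k. -/
namespace SkewPolynomialExtension

variable {B R : Type*} [Ring B] [Ring R]

/-- The coefficient isomorphism for a ring that is a free right module on the powers of `X`. -/
theorem exists_coeffEquiv (ι : B →+* R) (X : R)
    (hfree : ∀ r : R, ∃! c : ℕ →₀ B, r = c.sum fun i b => X ^ i * ι b) :
    ∃ e : (ℕ →₀ B) ≃+ R, ∀ i b, e (Finsupp.single i b) = X ^ i * ι b := by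
  let φ : (ℕ →₀ B) →+ R :=
    Finsupp.liftAddHom fun i => (AddMonoidHom.mulLeft (X ^ i)).comp ι.toAddMonoidHom
  have hφ : ∀ c, φ c = c.sum fun i b => X ^ i * ι b := fun c => rfl
  have hbij : Function.Bijective φ := by
    refine ⟨fun c d h => ?_, fun r => ?_⟩
    · exact (hfree (φ c)).unique (hφ c) (h.trans (hφ d))
    · obtain ⟨c, hc, -⟩ := hfree r
      exact ⟨c, hc.symm⟩
  refine ⟨AddEquiv.ofBijective φ hbij, fun i b => ?_⟩
  simp [φ]

variable {ι : B →+* R} {X : R} {e : (ℕ →₀ B) ≃+ R}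

theorem induction_monomial (he : ∀ i b, e (Finsupp.single i b) = X ^ i * ι b) {p : R → Prop}
    (zero : p 0) (add : ∀ r s, p r → p s → p (r + s)) (monomial : ∀ i b, p (X ^ i * ι b))
    (r : R) : p r := by
  obtain ⟨c, rfl⟩ := e.surjective r
  induction c using Finsupp.induction_linear with
  | zero => simpa using zero
  | add c d hc hd => simpa using add _ _ hc hd
  | single i b => simpa [he] using monomial i b

theorem coeff_monomial (he : ∀ i b, e (Finsupp.single i b) = X ^ i * ι b) (i : ℕ) (b : B) :
    e.symm (X ^ i * ι b) = Finsupp.single i b := by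
  rw [← he, e.symm_apply_apply]

theorem coeff_X_pow_mul (he : ∀ i b, e (Finsupp.single i b) = X ^ i * ι b) (n t : ℕ) (r : R) :
    e.symm (X ^ n * r) (n + t) = e.symm r t := by
  induction r using induction_monomial he with
  | zero => simp
  | add r s hr hs => simp [mul_add, hr, hs]
  | monomial i b =>
    rw [← mul_assoc, ← pow_add, coeff_monomial he, coeff_monomial he]
    simp [Finsupp.single_apply]

theorem coeff_mul_const (he : ∀ i b, e (Finsupp.single i b) = X ^ i * ι b) (b : B) (t : ℕ)
    (r : R) : e.symm (r * ι b) t = e.symm r t * b := by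
  induction r using induction_monomial he with
  | zero => simp
  | add r s hr hs => simp [add_mul, hr, hs]
  | monomial i c =>
    rw [mul_assoc, ← map_mul, coeff_monomial he, coeff_monomial he]
    simp only [Finsupp.single_apply, ite_mul, zero_mul]

theorem coeff_const_mul_X_pow (he : ∀ i b, e (Finsupp.single i b) = X ^ i * ι b)
    {ρ : B ≃+* B} {D : B →+ B} (hcomm : ∀ α : B, ι α * X = X * ι (ρ α) + ι (D α))
    (n : ℕ) (α : B) {t : ℕ} (ht : n < t) : e.symm (ι α * X ^ n) t = 0 := by
  induction n generalizing α t with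
  | zero =>
    have h := coeff_monomial he 0 α
    rw [pow_zero, one_mul] at h
    rw [pow_zero, mul_one, h, Finsupp.single_eq_of_ne (by omega)]
  | succ n ih =>
    obtain ⟨s, rfl⟩ : ∃ s, t = 1 + s := ⟨t - 1, by omega⟩
    have h := coeff_X_pow_mul he 1 s (ι (ρ α) * X ^ n)
    rw [pow_one] at h
    rw [pow_succ', ← mul_assoc, hcomm, add_mul, mul_assoc, e.symm.map_add, Finsupp.add_apply, h,
      ih _ (by omega), ih _ (by omega), add_zero]

section Monic

variable {ρ : B ≃+* B} {D : B →+ B} {m : ℕ} {a : ℕ → B} {f : R}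

theorem coeff_monic_mul_monomial (he : ∀ i b, e (Finsupp.single i b) = X ^ i * ι b)
    (hcomm : ∀ α : B, ι α * X = X * ι (ρ α) + ι (D α)) (ham : a m = 1)
    (hf : f = ∑ i ∈ Finset.range (m + 1), X ^ i * ι (a i)) (j : ℕ) (b : B) {t : ℕ}
    (ht : m + j ≤ t) : e.symm (f * (X ^ j * ι b)) t = if m + j = t then b else 0 := by
  have hlow : ∀ i ∈ Finset.range m, e.symm (X ^ i * ι (a i) * X ^ j) t = 0 := by
    intro i hi
    rw [Finset.mem_range] at hi
    obtain ⟨s, rfl⟩ : ∃ s, t = i + s := ⟨t - i, by omega⟩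
    rw [mul_assoc, coeff_X_pow_mul he, coeff_const_mul_X_pow he hcomm _ _ (by omega)]
  have htop : e.symm (X ^ (m + j)) = Finsupp.single (m + j) 1 := by
    simpa using coeff_monomial he (m + j) 1
  rw [← mul_assoc, coeff_mul_const he, hf, Finset.sum_mul, map_sum, Finsupp.finsetSum_apply,
    Finset.sum_range_succ, Finset.sum_eq_zero hlow, ham, map_one, mul_one, ← pow_add, htop,
    Finsupp.single_apply]
  simp

/-- A right multiple of a monic polynomial of degree `m` with no coefficients in degrees `≥ m`
vanishes. -/
theorem eq_zero_of_coeff_monic_mul (he : ∀ i b, e (Finsupp.single i b) = X ^ i * ι b)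
    (hcomm : ∀ α : B, ι α * X = X * ι (ρ α) + ι (D α)) (ham : a m = 1)
    (hf : f = ∑ i ∈ Finset.range (m + 1), X ^ i * ι (a i)) {s : R}
    (hs : ∀ t, m ≤ t → e.symm (f * s) t = 0) : s = 0 := by
  by_contra hne
  obtain ⟨c, rfl⟩ := e.surjective s
  have hc : c.support.Nonempty := by
    rw [Finsupp.support_nonempty_iff]
    rintro rfl
    simp at hne
  set n := c.support.max' hc
  have hmem : n ∈ c.support := c.support.max'_mem hc
  have hsum : e c = ∑ j ∈ c.support, X ^ j * ι (c j) := by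
    conv_lhs => rw [← c.sum_single]
    simp only [Finsupp.sum, map_sum, he]
  have h := hs (m + n) (by omega)
  rw [hsum, Finset.mul_sum, map_sum, Finsupp.finsetSum_apply, Finset.sum_congr rfl fun j hj =>
    coeff_monic_mul_monomial he hcomm ham hf j (c j)
      (Nat.add_le_add_left (c.support.le_max' j hj) m)] at h
  simp only [add_right_inj, Finset.sum_ite_eq', hmem, if_true] at h
  exact Finsupp.mem_support_iff.mp hmem h

/-- The derivation kills the coefficients of a monic `f` with `ρ`-fixed coefficients if
`X * f` is a right multiple of `f`. -/
theorem derivation_coeff_eq_zero (he : ∀ i b, e (Finsupp.single i b) = X ^ i * ι b)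
    (hD : ∀ α β : B, D (α * β) = D α * ρ β + α * D β)
    (hcomm : ∀ α : B, ι α * X = X * ι (ρ α) + ι (D α)) (ham : a m = 1)
    (hρa : ∀ i ≤ m, ρ (a i) = a i)
    (hf : f = ∑ i ∈ Finset.range (m + 1), X ^ i * ι (a i))
    (hXf : ∃ r, X * f = f * r) {i : ℕ} (hi : i ≤ m) : D (a i) = 0 := by
  have hD1 : D 1 = 0 := by simpa using hD 1 1
  obtain ⟨r, hr⟩ := hXf
  have hw : f * (X - r) = ∑ i ∈ Finset.range (m + 1), X ^ i * ι (D (a i)) := by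
    rw [mul_sub, ← hr, hf, Finset.sum_mul, Finset.mul_sum, ← Finset.sum_sub_distrib]
    refine Finset.sum_congr rfl fun j hj => ?_
    rw [mul_assoc, hcomm, hρa j (by simpa [Nat.lt_succ_iff] using hj), mul_add,
      ← mul_assoc, ← mul_assoc, ← pow_succ, ← pow_succ', add_sub_cancel_left]
  have hcoeff : ∀ t, e.symm (f * (X - r)) t = if t ≤ m then D (a t) else 0 := by
    intro t
    rw [hw, map_sum, Finsupp.finsetSum_apply]
    simp only [coeff_monomial he, Finsupp.single_apply, Finset.sum_ite_eq', Finset.mem_range,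
      Nat.lt_succ_iff]
  have hzero : X - r = 0 := by
    refine eq_zero_of_coeff_monic_mul he hcomm ham hf fun t ht => ?_
    rw [hcoeff]
    split_ifs with h
    · rw [le_antisymm h ht, ham, hD1]
    · rfl
  have h := hcoeff i
  rw [hzero] at h
  simpa [hi] using h.symm

end Monic

/-- Telescoping of `Σ y_j (u x - x u) x^j` along the
Horner recursion `y_j = x y_{j+1} + b_{j+1}`. -/
theorem sum_horner_commutator {A : Type*} [Ring A] {m : ℕ} {x u : A} {b y : ℕ → A}
    (hyx : ∀ j, Commute (y j) x) (hzero : x * y 0 + b 0 = 0)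
    (hy : ∀ j < m, y j = x * y (j + 1) + b (j + 1)) (hym : y m = 0) :
    ∑ j ∈ Finset.range m, y j * (u * x - x * u) * x ^ j =
      ∑ j ∈ Finset.range (m + 1), b j * u * x ^ j := by
  have hterm : ∀ n ≤ m, ∑ j ∈ Finset.range n, y j * (u * x - x * u) * x ^ j =
      ∑ j ∈ Finset.range (n + 1), b j * u * x ^ j + x * y n * u * x ^ n := by
    intro n hn
    induction n with
    | zero => simp [← add_mul, add_comm (b 0), hzero]
    | succ n ih =>
      rw [Finset.sum_range_succ, ih (by omega), Finset.sum_range_succ _ (n + 1), add_assoc,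
        add_assoc, add_right_inj]
      calc x * y n * u * x ^ n + y n * (u * x - x * u) * x ^ n
          = x * y n * u * x ^ n + (y n * u * (x * x ^ n) - y n * x * u * x ^ n) := by
            noncomm_ring
        _ = y n * u * x ^ (n + 1) := by rw [(hyx n).eq, ← pow_succ']; abel
        _ = _ := by rw [hy n (by omega)]; noncomm_ring
  simpa [hym] using hterm m le_rfl

end SkewPolynomialExtension

/-- In the setting of a monic `f = Σ_{i=0}^{m} X^i a_i` of degree `m ≥ 1` in `R = B[X;ρ,D]`
with all `a_i ∈ B^ρ` and `fR = Rf`, with `A = R/fR`, `x = X + fR`,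
`y_j = Σ_{k=j}^{m−1} x^{k−j} a_{k+1}` and `τ(z) = Σ_{j=0}^{m−1} y_j z x^j`:
for any integer `k`, the inner derivation `I_x` maps `A_k = {u : αu = uρ^k(α) for all α ∈ B}`
into the kernel of `τ`, i.e. `τ(ux − xu) = 0` for every `u ∈ A_k`. -/
theorem stmt5 {B R A : Type*} [Ring B] [Ring R] [Ring A]
    (ι : B →+* R) (hι : Function.Injective ι) (X : R)
    (ρ : B ≃+* B) (D : B →+ B)
    (hD : ∀ α β : B, D (α * β) = D α * ρ β + α * D β)
    (hcomm : ∀ α : B, ι α * X = X * ι (ρ α) + ι (D α))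
    (hfree : ∀ r : R, ∃! c : ℕ →₀ B, r = c.sum fun i b => X ^ i * ι b)
    (m : ℕ) (hm : 1 ≤ m) (a : ℕ → B) (ham : a m = 1)
    (hρa : ∀ i ≤ m, ρ (a i) = a i)
    (f : R) (hf : f = ∑ i ∈ Finset.range (m + 1), X ^ i * ι (a i))
    (htwo : (Set.range fun r => f * r) = Set.range fun r => r * f)
    (π : R →+* A) (hπ : Function.Surjective π)
    (hker : ∀ r : R, π r = 0 ↔ ∃ s, r = f * s)
    (y : ℕ → A)
    (hy : ∀ j, y j = ∑ k ∈ Finset.Icc j (m - 1), π X ^ (k - j) * π (ι (a (k + 1))))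
    (τ : A → A)
    (hτ : ∀ z, τ z = ∑ j ∈ Finset.range m, y j * z * π X ^ j)
    (k : ℤ) (u : A)
    (hu : ∀ α : B, π (ι α) * u = u * π (ι ((ρ ^ k) α))) :
    τ (u * π X - π X * u) = 0 := by
  obtain ⟨e, he⟩ := SkewPolynomialExtension.exists_coeffEquiv ι X hfree
  have hXf : ∃ r, X * f = f * r := by
    obtain ⟨r, hr⟩ : X * f ∈ Set.range fun r => f * r := htwo ▸ ⟨X, rfl⟩
    exact ⟨r, hr.symm⟩
  have hax : ∀ i ≤ m, Commute (π (ι (a i))) (π X) := by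
    intro i hi
    have h := hcomm (a i)
    rw [hρa i hi, SkewPolynomialExtension.derivation_coeff_eq_zero he hD hcomm ham hρa hf hXf hi,
      map_zero, add_zero] at h
    simpa [Commute, SemiconjBy] using congrArg π h
  have hroot : ∑ i ∈ Finset.range (m + 1), π X ^ i * π (ι (a i)) = 0 := by
    have h : π f = 0 := (hker f).2 ⟨1, (mul_one f).symm⟩
    simpa [hf] using h
  have hyx : ∀ j, Commute (y j) (π X) := by
    intro j
    rw [hy]
    refine Commute.sum_left _ _ _ fun i hi => ?_
    rw [Finset.mem_Icc] at hi
    exact ((Commute.refl _).pow_left _).mul_left (hax _ (by omega))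
  have hrec : ∀ j < m, y j = π X * y (j + 1) + π (ι (a (j + 1))) := by
    intro j hj
    rw [hy, hy, ← Finset.insert_Icc_add_one_left_eq_Icc (show j ≤ m - 1 by omega),
      Finset.sum_insert (by simp), Finset.mul_sum, add_comm]
    congr 1
    · refine Finset.sum_congr rfl fun i hi => ?_
      rw [Finset.mem_Icc] at hi
      rw [← mul_assoc, ← pow_succ', show i - (j + 1) + 1 = i - j by omega]
    · simp
  have hzero : π X * y 0 + π (ι (a 0)) = 0 := by
    rw [← hroot, Finset.sum_range_succ', hy, Finset.mul_sum, pow_zero, one_mul,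
      show Finset.Icc 0 (m - 1) = Finset.range m by ext; simp; omega]
    simp [← mul_assoc, pow_succ']
  have hym : y m = 0 := by
    rw [hy, Finset.Icc_eq_empty (by omega), Finset.sum_empty]
  have hρk : ∀ i ≤ m, (ρ ^ k) (a i) = a i := by
    intro i hi
    have h : ρ ∈ MulAction.stabilizer (B ≃+* B) (a i) := hρa i hi
    exact Subgroup.zpow_mem _ h k
  rw [hτ, SkewPolynomialExtension.sum_horner_commutator (b := fun i => π (ι (a i)))
    hyx hzero hrec hym]
  calc ∑ j ∈ Finset.range (m + 1), π (ι (a j)) * u * π X ^ j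
      = ∑ j ∈ Finset.range (m + 1), u * (π X ^ j * π (ι (a j))) := by
        refine Finset.sum_congr rfl fun j hj => ?_
        have hj : j ≤ m := Nat.lt_succ_iff.mp (Finset.mem_range.mp hj)
        rw [hu, hρk j hj, mul_assoc, ((hax j hj).pow_right j).eq]
    _ = 0 := by rw [← Finset.mul_sum, hroot, mul_zero]
end

section
/- For any g ∈ R_1 = {g ∈ R : αg = gρ(α) for all α ∈ B}, there exists a B-derivation Δ of R = B[X;ρ,D] (an additive map Δ : R → R with Δ(h_1 h_2) = Δ(h_1)h_2 + h_1Δ(h_2) for all h_1, h_2 ∈ R and Δ(β) = 0 for all β ∈ B) such that Δ(X) = g. -/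
/-- If `R` is free as a right `B`-module on the powers of `X`, every sequence `d` in `R` extends to
an additive map with `X ^ i * ι b ↦ d i * ι b`. -/
theorem exists_addMonoidHom_pow_mul {B R : Type*} [Ring B] [Ring R] (ι : B →+* R) (X : R)
    (hfree : ∀ r : R, ∃! c : ℕ →₀ B, r = c.sum fun i b => X ^ i * ι b) (d : ℕ → R) :
    ∃ Δ : R →+ R, ∀ i b, Δ (X ^ i * ι b) = d i * ι b := by
  let combination (f : ℕ → R) : (ℕ →₀ B) →+ R :=
    Finsupp.liftAddHom fun i => (AddMonoidHom.mulLeft (f i)).comp ι.toAddMonoidHom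
  have combination_single (f : ℕ → R) (i : ℕ) (b : B) :
      combination f (Finsupp.single i b) = f i * ι b := by
    simp [combination]
  have hbij : Function.Bijective (combination fun i => X ^ i) := by
    refine (Function.bijective_iff_existsUnique _).2 fun r => ?_
    simpa [combination, eq_comm, Finsupp.liftAddHom_apply, Function.comp_def] using hfree r
  let e := AddEquiv.ofBijective _ hbij
  refine ⟨(combination d).comp e.symm.toAddMonoidHom, fun i b => ?_⟩
  have he : e.symm (X ^ i * ι b) = Finsupp.single i b :=
    e.symm_apply_eq.2 (combination_single _ i b).symm
  simp [he, combination_single]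

/-- An additive map `Δ` killing `ι B` and satisfying `Δ (X * r) = g * r + X * Δ r` commutes with left
multiplication by `ι B` on the monomials `X ^ i * ι b`. -/
theorem map_coeff_mul_pow_mul {B R : Type*} [Ring B] [Ring R] (ι : B →+* R) (X : R)
    (ρ : B → B) (D : B → B) (hcomm : ∀ α : B, ι α * X = X * ι (ρ α) + ι (D α))
    (g : R) (hg : ∀ α : B, ι α * g = g * ι (ρ α)) (Δ : R →+ R)
    (hcoeff : ∀ b, Δ (ι b) = 0) (hX : ∀ r, Δ (X * r) = g * r + X * Δ r) (i : ℕ) (α b : B) :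
    Δ (ι α * (X ^ i * ι b)) = ι α * Δ (X ^ i * ι b) := by
  induction i generalizing α with
  | zero => simp [← map_mul, hcoeff]
  | succ i ih =>
    rw [pow_succ', mul_assoc X]
    generalize X ^ i * ι b = r at ih ⊢
    calc Δ (ι α * (X * r)) = Δ (X * (ι (ρ α) * r) + ι (D α) * r) := by
          rw [← mul_assoc, hcomm, add_mul, mul_assoc]
      _ = g * ι (ρ α) * r + (X * ι (ρ α) + ι (D α)) * Δ r := by
          rw [map_add, hX, ih, ih]; noncomm_ring
      _ = ι α * Δ (X * r) := by
          rw [← hg, ← hcomm, hX]; noncomm_ring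

/-- For any `g ∈ R_1 = {g ∈ R : αg = gρ(α) for all α ∈ B}` in the skew polynomial ring
`R = B[X;ρ,D]`, there exists a `B`-derivation `Δ` of `R` (an additive map `Δ : R → R`
with `Δ(h₁h₂) = Δ(h₁)h₂ + h₁Δ(h₂)` for all `h₁, h₂ ∈ R` and `Δ(β) = 0` for all `β ∈ B`)
such that `Δ(X) = g`. -/
theorem stmt9 {B R : Type*} [Ring B] [Ring R]
    (ι : B →+* R) (hι : Function.Injective ι) (X : R)
    (ρ : B ≃+* B) (D : B →+ B)
    (hD : ∀ α β : B, D (α * β) = D α * ρ β + α * D β)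
    (hcomm : ∀ α : B, ι α * X = X * ι (ρ α) + ι (D α))
    (hfree : ∀ r : R, ∃! c : ℕ →₀ B, r = c.sum fun i b => X ^ i * ι b)
    (g : R) (hg : ∀ α : B, ι α * g = g * ι (ρ α)) :
    ∃ Δ : R → R, (∀ h₁ h₂ : R, Δ (h₁ + h₂) = Δ h₁ + Δ h₂) ∧
      (∀ h₁ h₂ : R, Δ (h₁ * h₂) = Δ h₁ * h₂ + h₁ * Δ h₂) ∧
      (∀ β : B, Δ (ι β) = 0) ∧ Δ X = g := by
  let d : ℕ → R := fun n => Nat.rec 0 (fun i x => g * X ^ i + X * x) n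
  have hd (i : ℕ) : d (i + 1) = g * X ^ i + X * d i := rfl
  obtain ⟨Δ, hΔ⟩ := exists_addMonoidHom_pow_mul ι X hfree d
  have monomial_induction (P : R → Prop) (hadd : ∀ r s, P r → P s → P (r + s))
      (hmon : ∀ i b, P (X ^ i * ι b)) (r : R) : P r := by
    obtain ⟨c, rfl, -⟩ := hfree r
    exact Finset.sum_induction _ P hadd (by simpa using hmon 0 0) fun i _ => hmon i (c i)
  have hcoeff (b : B) : Δ (ι b) = 0 := by simpa [d] using hΔ 0 b
  have hX (r : R) : Δ (X * r) = g * r + X * Δ r := by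
    induction r using monomial_induction with
    | hadd r s hr hs => rw [mul_add, map_add, hr, hs, map_add]; noncomm_ring
    | hmon i b => rw [← mul_assoc, ← pow_succ', hΔ, hΔ, hd]; noncomm_ring
  have hleft (α : B) (r : R) : Δ (ι α * r) = ι α * Δ r := by
    induction r using monomial_induction with
    | hadd r s hr hs => rw [mul_add, map_add, hr, hs, map_add, mul_add]
    | hmon i b => exact map_coeff_mul_pow_mul ι X ρ D hcomm g hg Δ hcoeff hX i α b
  have hΔX : Δ X = g := by simpa [show Δ 1 = 0 by simpa using hcoeff 1] using hX 1
  refine ⟨Δ, map_add Δ, fun h₁ h₂ => ?_, hcoeff, hΔX⟩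
  induction h₁ using monomial_induction with
  | hadd r s hr hs => rw [add_mul, map_add, hr, hs, map_add]; noncomm_ring
  | hmon i b =>
    induction i with
    | zero => simp [hleft, hcoeff]
    | succ i ih =>
      rw [pow_succ', mul_assoc X, mul_assoc X, hX, ih, hX]
      noncomm_ring
end

section
/- The polynomial f is weakly separable in R = B[X;ρ,D] (i.e., every B-derivation of A = R/fR is inner) if and only if A_1 ∩ Ker(τ) = I_x(V), where V is the centralizer of B in A. -/
namespace OreExtension

variable {B R A : Type*} [Ring B] [Ring R] [Ring A]

/-- The coefficient isomorphism of a free right module with basis the powers of `X`. -/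
theorem exists_coeff (ι : B →+* R) (X : R)
    (hfree : ∀ r : R, ∃! c : ℕ →₀ B, r = c.sum fun i b => X ^ i * ι b) :
    ∃ e : (ℕ →₀ B) ≃+ R, ∀ i b, e (Finsupp.single i b) = X ^ i * ι b := by
  let g : (ℕ →₀ B) →+ R :=
    Finsupp.liftAddHom fun i => (AddMonoidHom.mulLeft (X ^ i)).comp ι.toAddMonoidHom
  have hg : ∀ c, g c = c.sum fun i b => X ^ i * ι b := fun c => rfl
  refine ⟨AddEquiv.ofBijective g ⟨fun c₁ c₂ h => ?_, fun r => ?_⟩, fun i b => ?_⟩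
  · exact (hfree (g c₁)).unique (hg c₁) (h.trans (hg c₂))
  · obtain ⟨c, hc, -⟩ := hfree r
    exact ⟨c, hc.symm⟩
  · exact (hg _).trans (Finsupp.sum_single_index (by simp))

variable {ι : B →+* R} {X : R} {ρ : B ≃+* B} {D : B →+ B} {e : (ℕ →₀ B) ≃+ R}

theorem induction_monomial (he : ∀ i b, e (Finsupp.single i b) = X ^ i * ι b)
    {P : R → Prop} (r : R) (zero : P 0) (sum : ∀ r s, P r → P s → P (r + s))
    (monomial : ∀ i b, P (X ^ i * ι b)) : P r := by
  obtain ⟨c, rfl⟩ := e.surjective r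
  induction c using Finsupp.induction_linear with
  | zero => simpa using zero
  | add c₁ c₂ h₁ h₂ => simpa using sum _ _ h₁ h₂
  | single i b => simpa [he] using monomial i b

theorem induction_generators (he : ∀ i b, e (Finsupp.single i b) = X ^ i * ι b)
    {P : R → Prop} (r : R) (sum : ∀ r s, P r → P s → P (r + s))
    (mul : ∀ r s, P r → P s → P (r * s)) (coe : ∀ b, P (ι b)) (var : P X) : P r := by
  have hpow : ∀ i, P (X ^ i) := by
    intro i
    induction i with
    | zero => simpa using coe 1
    | succ i ih => simpa [pow_succ] using mul _ _ ih var
  exact induction_monomial he r (by simpa using coe 0) sum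
    fun i b => mul _ _ (hpow i) (coe b)

theorem monomial_mul_X (hcomm : ∀ α : B, ι α * X = X * ι (ρ α) + ι (D α)) (i : ℕ) (b : B) :
    X ^ i * ι b * X = X ^ (i + 1) * ι (ρ b) + X ^ i * ι (D b) := by
  rw [mul_assoc, hcomm, mul_add, pow_succ, mul_assoc]

/-- The universal property of the skew polynomial ring. -/
theorem exists_lift (he : ∀ i b, e (Finsupp.single i b) = X ^ i * ι b)
    (hcomm : ∀ α : B, ι α * X = X * ι (ρ α) + ι (D α))
    {S : Type*} [Ring S] (β : B →+* S) (ξ : S)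
    (hξ : ∀ α : B, β α * ξ = ξ * β (ρ α) + β (D α)) :
    ∃ φ : R →+* S, φ X = ξ ∧ ∀ b, φ (ι b) = β b := by
  let g : R →+ S := (Finsupp.liftAddHom fun i =>
    (AddMonoidHom.mulLeft (ξ ^ i)).comp β.toAddMonoidHom).comp e.symm.toAddMonoidHom
  have hg : ∀ i b, g (X ^ i * ι b) = ξ ^ i * β b := by
    intro i b
    simp [g, ← he]
  have hgX : ∀ r, g (r * X) = g r * ξ := by
    intro r
    refine induction_monomial he (P := fun r => g (r * X) = g r * ξ) r (by simp)
      (fun r s hr hs => ?_) fun i b => ?_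
    · rw [add_mul, map_add, hr, hs, map_add, add_mul]
    · rw [monomial_mul_X hcomm, map_add, hg, hg, hg, mul_assoc, hξ, mul_add, pow_succ, mul_assoc]
  have hgι : ∀ r b, g (r * ι b) = g r * β b := by
    intro r b
    refine induction_monomial he (P := fun r => g (r * ι b) = g r * β b) r (by simp)
      (fun r s hr hs => ?_) fun i c => ?_
    · rw [add_mul, map_add, hr, hs, map_add, add_mul]
    · rw [mul_assoc, ← map_mul, hg, hg, map_mul, mul_assoc]
  have hone : g 1 = 1 := by simpa using hg 0 1
  have hmul : ∀ r s, g (r * s) = g r * g s := by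
    intro r s
    revert r
    refine induction_generators he (P := fun s => ∀ r, g (r * s) = g r * g s) s
      (fun s t hs ht r => ?_) (fun s t hs ht r => ?_)
      (fun b r => ?_) fun r => ?_
    · rw [mul_add, map_add, hs, ht, map_add, mul_add]
    · rw [← mul_assoc, ht, hs, ht, mul_assoc]
    · have := hgι 1 b
      rw [hgι, ← one_mul (ι b), this, hone, one_mul]
    · have := hgX 1
      rw [hgX, ← one_mul X, this, hone, one_mul]
  refine ⟨{ g with map_one' := hone, map_mul' := hmul }, ?_, fun b => ?_⟩
  · simpa using hg 1 1
  · simpa using hg 0 b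

theorem coeff_mul_coe (he : ∀ i b, e (Finsupp.single i b) = X ^ i * ι b) (r : R) (b : B) (n : ℕ) :
    e.symm (r * ι b) n = e.symm r n * b := by
  refine induction_monomial he
    (P := fun r => e.symm (r * ι b) n = e.symm r n * b) r (by simp)
      (fun r s hr hs => ?_) fun i c => ?_
  · simp [add_mul, hr, hs]
  · rw [mul_assoc, ← map_mul, ← he, ← he]
    by_cases h : i = n <;> simp [h]

theorem coeff_mul_X (he : ∀ i b, e (Finsupp.single i b) = X ^ i * ι b)
    (hcomm : ∀ α : B, ι α * X = X * ι (ρ α) + ι (D α)) (r : R) (n : ℕ) :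
    e.symm (r * X) (n + 1) = ρ (e.symm r n) + D (e.symm r (n + 1)) := by
  refine induction_monomial he
    (P := fun r => e.symm (r * X) (n + 1) = ρ (e.symm r n) + D (e.symm r (n + 1))) r (by simp)
    (fun r s hr hs => ?_) fun i c => ?_
  · simp only [add_mul, map_add, Finsupp.add_apply, hr, hs]
    abel
  · rw [monomial_mul_X hcomm, map_add e.symm, Finsupp.add_apply, ← he, ← he, ← he]
    simp only [AddEquiv.symm_apply_apply, Finsupp.single_apply, Nat.add_right_cancel_iff,
      apply_ite ρ, apply_ite D, map_zero]

/-- A monic element of degree `m` has no nonzero right multiple of degree less than `m`. -/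
theorem mul_eq_zero_of_coeff (he : ∀ i b, e (Finsupp.single i b) = X ^ i * ι b)
    (hcomm : ∀ α : B, ι α * X = X * ι (ρ α) + ι (D α)) {f s : R} {m : ℕ}
    (hlead : e.symm f m = 1) (hdeg : ∀ n > m, e.symm f n = 0)
    (hlow : ∀ n ≥ m, e.symm (f * s) n = 0) : s = 0 := by
  have hpow : ∀ k, e.symm (f * X ^ k) (m + k) = 1 ∧ ∀ n > m + k, e.symm (f * X ^ k) n = 0 := by
    intro k
    induction k with
    | zero => simpa using ⟨hlead, hdeg⟩
    | succ k ih =>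
      rw [pow_succ, ← mul_assoc, ← add_assoc]
      constructor
      · rw [coeff_mul_X he hcomm, ih.1, ih.2 _ (by omega), map_one, map_zero, add_zero]
      · intro n hn
        obtain ⟨n, rfl⟩ : ∃ l, n = l + 1 := ⟨n - 1, by omega⟩
        rw [coeff_mul_X he hcomm, ih.2 _ (by omega), ih.2 _ (by omega), map_zero, map_zero,
          add_zero]
  obtain ⟨c, rfl⟩ := e.surjective s
  by_contra hc
  have hc0 : c ≠ 0 := fun h => hc (by simp [h])
  have hne : c.support.Nonempty := Finsupp.support_nonempty_iff.mpr hc0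
  set N := c.support.max' hne with hN
  have hNmem : N ∈ c.support := c.support.max'_mem hne
  have hsum : e c = ∑ i ∈ c.support, X ^ i * ι (c i) := by
    conv_lhs => rw [← Finsupp.sum_single c]
    simp [Finsupp.sum, he]
  have hcoeff : e.symm (f * e c) (m + N) = c N := by
    rw [hsum, Finset.mul_sum, map_sum, Finsupp.finsetSum_apply, Finset.sum_eq_single N]
    · rw [← mul_assoc, coeff_mul_coe he, (hpow N).1, one_mul]
    · intro i hi hiN
      have := c.support.le_max' i hi
      rw [← mul_assoc, coeff_mul_coe he, (hpow i).2 _ (by omega), zero_mul]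
    · exact fun h => absurd hNmem h
  exact Finsupp.mem_support_iff.mp hNmem (hcoeff ▸ hlow _ (by omega))

/-- If `Xf ∈ fR` for a monic `f` with `ρ`-invariant coefficients, then these coefficients are
killed by `D`. -/
theorem derivation_coeff_eq_zero (he : ∀ i b, e (Finsupp.single i b) = X ^ i * ι b)
    (hD : ∀ α β : B, D (α * β) = D α * ρ β + α * D β)
    (hcomm : ∀ α : B, ι α * X = X * ι (ρ α) + ι (D α))
    {m : ℕ} {a : ℕ → B} (ham : a m = 1) (hρa : ∀ i ≤ m, ρ (a i) = a i) {f : R}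
    (hf : f = ∑ i ∈ Finset.range (m + 1), X ^ i * ι (a i)) {s : R} (hs : X * f = f * s) :
    ∀ i ≤ m, D (a i) = 0 := by
  have hcoeff : ∀ (b : ℕ → B) (n : ℕ),
      e.symm (∑ i ∈ Finset.range (m + 1), X ^ i * ι (b i)) n = if n ≤ m then b n else 0 := by
    intro b n
    simp [← he, Finsupp.finsetSum_apply, Finsupp.single_apply]
  have hD1 : D 1 = 0 := by simpa using hD 1 1
  have hdiff : f * (X - s) = ∑ i ∈ Finset.range (m + 1), X ^ i * ι (D (a i)) := by
    rw [mul_sub, ← hs, hf, Finset.sum_mul, Finset.mul_sum, ← Finset.sum_sub_distrib]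
    refine Finset.sum_congr rfl fun i hi => ?_
    rw [monomial_mul_X hcomm, hρa i (by simpa [Nat.lt_succ_iff] using hi), pow_succ', mul_assoc,
      add_sub_cancel_left]
  have hzero : X - s = 0 := by
    refine mul_eq_zero_of_coeff he hcomm (f := f) (m := m) ?_ (fun n hn => ?_) fun n hn => ?_
    · rw [hf, hcoeff, if_pos le_rfl, ham]
    · rw [hf, hcoeff, if_neg (by omega)]
    · rw [hdiff, hcoeff]
      split_ifs with h
      · rw [le_antisymm h hn, ham, hD1]
      · rfl
  intro i hi
  have h := hcoeff (fun i => D (a i)) i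
  rw [← hdiff, hzero, mul_zero, map_zero, if_pos hi] at h
  simpa using h.symm

/-- Leibniz rule for powers, for a derivation along a ring homomorphism. -/
theorem leibniz_pow {π : R →+* A} {d : R → A}
    (hmul : ∀ r s, d (r * s) = d r * π s + π r * d s) (r : R) (n : ℕ) :
    d (r ^ n) = ∑ j ∈ Finset.range n, π r ^ (n - 1 - j) * d r * π r ^ j := by
  induction n with
  | zero => simpa using hmul 1 1
  | succ n ih =>
    rw [pow_succ', hmul, ih, Finset.sum_range_succ, Finset.mul_sum, add_comm]
    congr 1
    · refine Finset.sum_congr rfl fun j hj => ?_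
      have hj := Finset.mem_range.mp hj
      rw [← mul_assoc, ← mul_assoc, ← pow_succ']
      congr 3
      omega
    · simp

/-- A derivation `d` along `π` vanishing on `B` maps `f` to `τ (d X)`. -/
theorem leibniz_eq_trace {π : R →+* A} {d : R → A}
    (hadd : ∀ r s, d (r + s) = d r + d s)
    (hmul : ∀ r s, d (r * s) = d r * π s + π r * d s) (hι : ∀ b, d (ι b) = 0)
    {m : ℕ} {a : ℕ → B} (hX : ∀ i ≤ m, Commute (ι (a i)) X)
    (hd : ∀ i ≤ m, Commute (π (ι (a i))) (d X)) :
    d (∑ i ∈ Finset.range (m + 1), X ^ i * ι (a i)) =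
      ∑ j ∈ Finset.range m, (∑ k ∈ Finset.Icc j (m - 1), π X ^ (k - j) * π (ι (a (k + 1)))) *
        d X * π X ^ j := by
  have hterm : ∀ i, d (X ^ i * ι (a i)) = d (X ^ i) * π (ι (a i)) := by simp [hmul, hι]
  have hsum : ∀ s : Finset ℕ, d (∑ i ∈ s, X ^ i * ι (a i)) = ∑ i ∈ s, d (X ^ i * ι (a i)) :=
    fun s => map_sum (AddMonoidHom.mk' d hadd) _ s
  rw [hsum, Finset.sum_range_succ', hterm 0]
  simp only [hterm, leibniz_pow hmul, Finset.sum_mul, Finset.range_zero, Finset.sum_empty,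
    zero_mul, add_zero, Nat.add_sub_cancel]
  rw [Finset.sum_comm' (t' := Finset.range m) (s' := fun j => Finset.Icc j (m - 1))
    (by intro k j; simp only [Finset.mem_range, Finset.mem_Icc]; omega)]
  refine Finset.sum_congr rfl fun j hj => Finset.sum_congr rfl fun k hk => ?_
  have hj := Finset.mem_range.mp hj
  have hk := (Finset.mem_Icc.mp hk).2
  have h := (hd (k + 1) (by omega)).mul_right (((hX (k + 1) (by omega)).map π).pow_right j)
  simp only [mul_assoc] at h ⊢
  rw [← mul_assoc (d X), ← h.eq]

/-- Every `u ∈ A₁` is the value at `X` of a derivation along `π` vanishing on `B`. -/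
theorem exists_derivation (he : ∀ i b, e (Finsupp.single i b) = X ^ i * ι b)
    (hcomm : ∀ α : B, ι α * X = X * ι (ρ α) + ι (D α)) (π : R →+* A) (u : A)
    (hu : ∀ α : B, π (ι α) * u = u * π (ι (ρ α))) :
    ∃ d : R →+ A, d X = u ∧ (∀ b, d (ι b) = 0) ∧
      ∀ r s, d (r * s) = d r * π s + π r * d s := by
  obtain ⟨φ, hφX, hφι⟩ := exists_lift he hcomm
    ((TrivSqZeroExt.inlHom A A).comp (π.comp ι))
    (TrivSqZeroExt.inl (π X) + TrivSqZeroExt.inr u) (by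
      intro α
      ext
      · simp [← map_mul, ← map_add, hcomm]
      · simp [hu])
  have hfst : ∀ r, (φ r).fst = π r := by
    intro r
    refine induction_generators he (P := fun r => (φ r).fst = π r) r
      (fun r s hr hs => ?_) (fun r s hr hs => ?_) (fun b => ?_) ?_
    · simp [hr, hs]
    · simp [hr, hs]
    · simp [hφι]
    · simp [hφX]
  refine ⟨AddMonoidHom.mk' (fun r => (φ r).snd) (by simp), ?_, ?_, ?_⟩
  · simp [hφX]
  · simp [hφι]
  · intro r s
    simp [hfst, add_comm]

end OreExtension

/-- Let `f = Σ_{i=0}^{m} X^i a_i` be monic of degree `m ≥ 1` in `R = B[X;ρ,D]` with all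
`a_i ∈ B^ρ` and `fR = Rf`, let `A = R/fR`, `x = X + fR`,
`y_j = Σ_{k=j}^{m−1} x^{k−j} a_{k+1}` and `τ(z) = Σ_{j=0}^{m−1} y_j z x^j`.
Then `f` is weakly separable in `R` (i.e. every `B`-derivation of `A` is inner) if and
only if `A_1 ∩ Ker(τ) = I_x(V)`, where `V` is the centralizer of `B` in `A`. -/
theorem stmt12 {B R A : Type*} [Ring B] [Ring R] [Ring A]
    (ι : B →+* R) (hι : Function.Injective ι) (X : R)
    (ρ : B ≃+* B) (D : B →+ B)
    (hD : ∀ α β : B, D (α * β) = D α * ρ β + α * D β)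
    (hcomm : ∀ α : B, ι α * X = X * ι (ρ α) + ι (D α))
    (hfree : ∀ r : R, ∃! c : ℕ →₀ B, r = c.sum fun i b => X ^ i * ι b)
    (m : ℕ) (hm : 1 ≤ m) (a : ℕ → B) (ham : a m = 1)
    (hρa : ∀ i ≤ m, ρ (a i) = a i)
    (f : R) (hf : f = ∑ i ∈ Finset.range (m + 1), X ^ i * ι (a i))
    (htwo : (Set.range fun r => f * r) = Set.range fun r => r * f)
    (π : R →+* A) (hπ : Function.Surjective π)
    (hker : ∀ r : R, π r = 0 ↔ ∃ s, r = f * s)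
    (y : ℕ → A)
    (hy : ∀ j, y j = ∑ k ∈ Finset.Icc j (m - 1), π X ^ (k - j) * π (ι (a (k + 1))))
    (τ : A → A)
    (hτ : ∀ z, τ z = ∑ j ∈ Finset.range m, y j * z * π X ^ j) :
    (∀ δ : A → A, (∀ z w : A, δ (z + w) = δ z + δ w) →
        (∀ z w : A, δ (z * w) = δ z * w + z * δ w) →
        (∀ β : B, δ (π (ι β)) = 0) →
        ∃ v : A, ∀ z : A, δ z = v * z - z * v) ↔
      {u : A | (∀ α : B, π (ι α) * u = u * π (ι (ρ α))) ∧ τ u = 0} =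
        (fun v => v * π X - π X * v) '' {v : A | ∀ α : B, π (ι α) * v = v * π (ι α)} := by
  obtain ⟨e, he⟩ := OreExtension.exists_coeff ι X hfree
  have hDa : ∀ i ≤ m, D (a i) = 0 := by
    obtain ⟨s, hs⟩ : X * f ∈ Set.range fun r => f * r := htwo ▸ ⟨X, rfl⟩
    exact OreExtension.derivation_coeff_eq_zero he hD hcomm ham hρa hf hs.symm
  have hX : ∀ i ≤ m, Commute (ι (a i)) X := by
    intro i hi
    rw [commute_iff_eq, hcomm, hρa i hi, hDa i hi, map_zero, add_zero]
  have hπf : π f = 0 := (hker f).mpr ⟨1, (mul_one f).symm⟩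
  have htrace : ∀ d : R → A, (∀ r s, d (r + s) = d r + d s) →
      (∀ r s, d (r * s) = d r * π s + π r * d s) → (∀ b, d (ι b) = 0) →
      (∀ α : B, π (ι α) * d X = d X * π (ι (ρ α))) → τ (d X) = d f := by
    intro d hadd hmul hι hd
    rw [hτ, hf, OreExtension.leibniz_eq_trace hadd hmul hι hX
      fun i hi => by rw [commute_iff_eq, hd, hρa i hi]]
    simp only [hy]
  have hmem : ∀ δ : A → A, (∀ z w : A, δ (z + w) = δ z + δ w) →
      (∀ z w : A, δ (z * w) = δ z * w + z * δ w) → (∀ β : B, δ (π (ι β)) = 0) →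
      (∀ α : B, π (ι α) * δ (π X) = δ (π X) * π (ι (ρ α))) ∧ τ (δ (π X)) = 0 := by
    intro δ hadd hmul hB
    have hA₁ : ∀ α : B, π (ι α) * δ (π X) = δ (π X) * π (ι (ρ α)) := by
      intro α
      have h := congrArg (fun r => δ (π r)) (hcomm α)
      simpa [hadd, hmul, hB] using h
    refine ⟨hA₁, ?_⟩
    rw [htrace (fun r => δ (π r)) (by simp [hadd]) (by simp [hmul]) hB hA₁, hπf]
    simpa using hadd 0 0
  have hinner : ∀ v : A, (∀ α : B, π (ι α) * v = v * π (ι α)) →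
      (∀ α : B, π (ι α) * (v * π X - π X * v) = (v * π X - π X * v) * π (ι (ρ α))) ∧
        τ (v * π X - π X * v) = 0 := fun v hv =>
    hmem (fun z => v * z - z * v) (fun z w => by noncomm_ring) (fun z w => by noncomm_ring)
      fun β => by rw [hv, sub_self]
  constructor
  · intro h
    ext u
    constructor
    · rintro ⟨hu, hτu⟩
      obtain ⟨d, hdX, hdι, hdmul⟩ := OreExtension.exists_derivation he hcomm π u hu
      have hdf : d f = 0 := by
        rw [← htrace d (map_add d) hdmul hdι (by rwa [hdX]), hdX, hτu]
      have hwd : ∀ r s, π r = π s → d r = d s := by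
        intro r s hrs
        obtain ⟨t, ht⟩ := (hker (r - s)).mp (by rw [map_sub, hrs, sub_self])
        rw [← sub_eq_zero, ← map_sub, ht, hdmul, hdf, hπf, zero_mul, zero_mul, add_zero]
      have hδ : ∀ r, d (Function.surjInv hπ (π r)) = d r :=
        fun r => hwd _ _ (Function.surjInv_eq hπ _)
      obtain ⟨v, hv⟩ := h (fun z => d (Function.surjInv hπ z))
        (fun z w => by
          obtain ⟨r, rfl⟩ := hπ z
          obtain ⟨s, rfl⟩ := hπ w
          rw [← map_add, hδ, hδ, hδ, map_add])
        (fun z w => by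
          obtain ⟨r, rfl⟩ := hπ z
          obtain ⟨s, rfl⟩ := hπ w
          rw [← map_mul, hδ, hδ, hδ, hdmul])
        (fun β => by rw [hδ, hdι])
      refine ⟨v, fun α => ?_, ?_⟩
      · have hα := hv (π (ι α))
        rw [hδ, hdι] at hα
        exact (sub_eq_zero.mp hα.symm).symm
      · have hx := hv (π X)
        rw [hδ, hdX] at hx
        exact hx.symm
    · rintro ⟨v, hv, rfl⟩
      exact hinner v hv
  · intro h δ hadd hmul hB
    obtain ⟨v, hv, hvx⟩ := h.subset (hmem δ hadd hmul hB)
    refine ⟨v, fun z => ?_⟩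
    obtain ⟨r, rfl⟩ := hπ z
    refine OreExtension.induction_generators he (P := fun r => δ (π r) = v * π r - π r * v) r
      (fun r s hr hs => ?_) (fun r s hr hs => ?_)
      (fun b => ?_) hvx.symm
    · rw [map_add, hadd, hr, hs]
      noncomm_ring
    · rw [map_mul, hmul, hr, hs]
      noncomm_ring
    · rw [hB, hv, sub_self]
end

section
/- In the derivation-type case R = B[X;D] (ρ = id), for any monic f = Σ_{i=0}^{m} X^i a_i of degree m ≥ 1 with fR = Rf, the map τ carries the centralizer V of B in A = R/fR into the center C(A) of A; that is, τ(V) ⊆ C(A). -/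
open Finset

/-- The value at `X ^ i` of the derivation sending `X` to `v`. -/
def powDeriv {A : Type*} [Ring A] (x v : A) (i : ℕ) : A :=
  ∑ k ∈ range i, x ^ (i - 1 - k) * v * x ^ k

theorem powDeriv_succ {A : Type*} [Ring A] (x v : A) (i : ℕ) :
    powDeriv x v (i + 1) = x * powDeriv x v i + v * x ^ i := by
  unfold powDeriv
  rw [sum_range_succ, mul_sum]
  congr 1
  · refine sum_congr rfl fun k hk => ?_
    have hk := mem_range.1 hk
    rw [show i + 1 - 1 - k = (i - 1 - k) + 1 by omega, pow_succ']
    simp only [mul_assoc]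
  · simp

theorem powDeriv_succ_right {A : Type*} [Ring A] (x v : A) (i : ℕ) :
    powDeriv x v (i + 1) = powDeriv x v i * x + x ^ i * v := by
  unfold powDeriv
  rw [sum_range_succ', sum_mul]
  congr 1
  · refine sum_congr rfl fun k hk => ?_
    rw [show i + 1 - 1 - (k + 1) = i - 1 - k by omega, pow_succ]
    simp only [mul_assoc]
  · simp

section SkewPolynomial

variable {B R : Type*} [Ring B] [Ring R] (ι : B →+* R) (X : R)

/-- Elements of degree less than `n`, as an additive subgroup. -/
def skewDegreeLT (n : ℕ) : AddSubgroup R :=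
  AddSubgroup.closure {r | ∃ i < n, ∃ b : B, r = X ^ i * ι b}

variable {ι X}

theorem pow_mul_mem_skewDegreeLT {i n : ℕ} (h : i < n) (b : B) :
    X ^ i * ι b ∈ skewDegreeLT ι X n :=
  AddSubgroup.subset_closure ⟨i, h, b, rfl⟩

theorem map_mem_of_mem_skewDegreeLT {M : Type*} [AddCommGroup M] {n : ℕ} (φ : R →+ M)
    (S : AddSubgroup M) (h : ∀ i < n, ∀ b : B, φ (X ^ i * ι b) ∈ S) {r : R}
    (hr : r ∈ skewDegreeLT ι X n) : φ r ∈ S := by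
  have : skewDegreeLT ι X n ≤ S.comap φ := by
    refine (AddSubgroup.closure_le _).2 ?_
    rintro _ ⟨i, hi, b, rfl⟩
    exact h i hi b
  exact this hr

theorem skewDegreeLT_mono {n k : ℕ} (h : n ≤ k) : skewDegreeLT ι X n ≤ skewDegreeLT ι X k :=
  fun _ hr => map_mem_of_mem_skewDegreeLT (AddMonoidHom.id R) _
    (fun _ hi b => pow_mul_mem_skewDegreeLT (hi.trans_le h) b) hr

theorem mul_coeff_mem_skewDegreeLT {n : ℕ} {r : R} (hr : r ∈ skewDegreeLT ι X n) (b : B) :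
    r * ι b ∈ skewDegreeLT ι X n :=
  map_mem_of_mem_skewDegreeLT (AddMonoidHom.mulRight (ι b)) _
    (fun i hi c => by
      simpa [mul_assoc] using pow_mul_mem_skewDegreeLT (ι := ι) (X := X) hi (c * b)) hr

theorem exists_addMonoidHom_skew
    (hfree : ∀ r : R, ∃! c : ℕ →₀ B, r = c.sum fun i b => X ^ i * ι b)
    {M : Type*} [AddCommGroup M] (g : ℕ → B →+ M) :
    ∃ δ : R →+ M, ∀ i b, δ (X ^ i * ι b) = g i b := by
  let e : (ℕ →₀ B) →+ R :=
    Finsupp.liftAddHom fun i => (AddMonoidHom.mulLeft (X ^ i)).comp ι.toAddMonoidHom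
  have he : ∀ c, e c = c.sum fun i b => X ^ i * ι b := fun c => rfl
  have hbij : Function.Bijective e := by
    refine ⟨fun c d h => (hfree (e c)).unique (he c) (h.trans (he d)), fun r => ?_⟩
    obtain ⟨c, hc, -⟩ := hfree r
    exact ⟨c, hc.symm⟩
  let E := AddEquiv.ofBijective e hbij
  refine ⟨(Finsupp.liftAddHom g).comp E.symm.toAddMonoidHom, fun i b => ?_⟩
  have h : E.symm (X ^ i * ι b) = Finsupp.single i b := by
    rw [AddEquiv.symm_apply_eq]
    change _ = e _
    simp [he]
  simp [h]

theorem exists_coeff_skew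
    (hfree : ∀ r : R, ∃! c : ℕ →₀ B, r = c.sum fun i b => X ^ i * ι b) (n : ℕ) :
    ∃ δ : R →+ B, ∀ i b, δ (X ^ i * ι b) = if i = n then b else 0 := by
  obtain ⟨δ, hδ⟩ := exists_addMonoidHom_skew hfree
    fun i => if i = n then AddMonoidHom.id B else 0
  refine ⟨δ, fun i b => ?_⟩
  rw [hδ]
  split_ifs <;> rfl

theorem eq_zero_of_pow_mul_mem_skewDegreeLT
    (hfree : ∀ r : R, ∃! c : ℕ →₀ B, r = c.sum fun i b => X ^ i * ι b) {n : ℕ} {b : B}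
    (h : X ^ n * ι b ∈ skewDegreeLT ι X n) : b = 0 := by
  obtain ⟨δ, hδ⟩ := exists_coeff_skew hfree n
  have := map_mem_of_mem_skewDegreeLT δ ⊥ (fun i hi c => by simp [hδ, hi.ne]) h
  simpa [hδ] using this

theorem exists_leading_skew {n : ℕ} {r : R} (hr : r ∈ skewDegreeLT ι X (n + 1)) :
    ∃ b, r - X ^ n * ι b ∈ skewDegreeLT ι X n := by
  induction hr using AddSubgroup.closure_induction with
  | mem r h =>
    obtain ⟨i, hi, b, rfl⟩ := h
    rcases Nat.lt_succ_iff_lt_or_eq.1 hi with hi | rfl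
    · exact ⟨0, by simpa using pow_mul_mem_skewDegreeLT hi b⟩
    · exact ⟨b, by simp [zero_mem]⟩
  | zero => exact ⟨0, by simp [zero_mem]⟩
  | add r s _ _ hr hs =>
    obtain ⟨b, hb⟩ := hr
    obtain ⟨c, hc⟩ := hs
    refine ⟨b + c, ?_⟩
    convert add_mem hb hc using 1
    rw [map_add, mul_add]
    abel
  | neg r _ hr =>
    obtain ⟨b, hb⟩ := hr
    refine ⟨-b, ?_⟩
    convert neg_mem hb using 1
    rw [map_neg, mul_neg]
    abel

variable {D : B →+ B}

theorem mul_X_mem_skewDegreeLT (hcomm : ∀ α : B, ι α * X = X * ι α + ι (D α)) {n : ℕ} {r : R}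
    (hr : r ∈ skewDegreeLT ι X n) : r * X ∈ skewDegreeLT ι X (n + 1) := by
  refine map_mem_of_mem_skewDegreeLT (AddMonoidHom.mulRight X) _ (fun i hi c => ?_) hr
  have : X ^ i * ι c * X = X ^ (i + 1) * ι c + X ^ i * ι (D c) := by
    rw [mul_assoc, hcomm, mul_add, pow_succ, mul_assoc]
  simp only [AddMonoidHom.mulRight_apply, this]
  exact add_mem (pow_mul_mem_skewDegreeLT (by omega) c) (pow_mul_mem_skewDegreeLT (by omega) _)

theorem mul_X_pow_mem_skewDegreeLT (hcomm : ∀ α : B, ι α * X = X * ι α + ι (D α)) {n : ℕ} {r : R}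
    (hr : r ∈ skewDegreeLT ι X n) (k : ℕ) : r * X ^ k ∈ skewDegreeLT ι X (n + k) := by
  induction k with
  | zero => simpa using hr
  | succ k ih =>
    rw [pow_succ, ← mul_assoc]
    exact mul_X_mem_skewDegreeLT hcomm ih

theorem commutator_pow_mem_skewDegreeLT (hcomm : ∀ α : B, ι α * X = X * ι α + ι (D α))
    (α : B) (i : ℕ) : ι α * X ^ i - X ^ i * ι α ∈ skewDegreeLT ι X i := by
  induction i with
  | zero => simp [zero_mem]
  | succ i ih =>
    have : ι α * X ^ (i + 1) - X ^ (i + 1) * ι α =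
        (ι α * X ^ i - X ^ i * ι α) * X + X ^ i * ι (D α) := by
      have h : ι (D α) = ι α * X - X * ι α := by rw [hcomm]; abel
      rw [h, pow_succ]
      noncomm_ring
    rw [this]
    exact add_mem (mul_X_mem_skewDegreeLT hcomm ih) (pow_mul_mem_skewDegreeLT (by omega) _)

theorem mem_skewDegreeLT_of_free
    (hfree : ∀ r : R, ∃! c : ℕ →₀ B, r = c.sum fun i b => X ^ i * ι b) (r : R) :
    ∃ n, r ∈ skewDegreeLT ι X n := by
  obtain ⟨c, hc, -⟩ := hfree r
  refine ⟨c.support.sup id + 1, ?_⟩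
  rw [hc]
  refine sum_mem fun i hi => pow_mul_mem_skewDegreeLT ?_ _
  exact Nat.lt_succ_of_le (le_sup (f := id) hi)

/-- A right multiple of a monic polynomial of degree `m` that has degree less than `m` vanishes. -/
theorem monic_mul_eq_zero (hcomm : ∀ α : B, ι α * X = X * ι α + ι (D α))
    (hfree : ∀ r : R, ∃! c : ℕ →₀ B, r = c.sum fun i b => X ^ i * ι b)
    {m : ℕ} {f s : R} (hf : f - X ^ m ∈ skewDegreeLT ι X m)
    (hs : f * s ∈ skewDegreeLT ι X m) : f * s = 0 := by
  obtain ⟨n, hn⟩ := mem_skewDegreeLT_of_free hfree s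
  have lower : ∀ (k : ℕ) (b : B),
      f * (X ^ k * ι b) - X ^ (m + k) * ι b ∈ skewDegreeLT ι X (m + k) := fun k b => by
    have := mul_coeff_mem_skewDegreeLT (mul_X_pow_mem_skewDegreeLT hcomm hf k) b
    convert this using 1
    rw [pow_add]
    noncomm_ring
  have mul_mem : ∀ (k : ℕ) (r : R), r ∈ skewDegreeLT ι X k →
      f * r ∈ skewDegreeLT ι X (m + k) := fun k r hr => by
    refine map_mem_of_mem_skewDegreeLT (AddMonoidHom.mulLeft f) _ (fun i hi c => ?_) hr
    have := add_mem (skewDegreeLT_mono (by omega : m + i ≤ m + k) (lower i c))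
      (pow_mul_mem_skewDegreeLT (ι := ι) (X := X) (by omega : m + i < m + k) c)
    simpa using this
  induction n with
  | zero =>
    have : s = 0 := by
      simpa using map_mem_of_mem_skewDegreeLT (AddMonoidHom.id R) ⊥
        (fun i hi => absurd hi (Nat.not_lt_zero i)) hn
    simp [this]
  | succ n ih =>
    obtain ⟨b, hb⟩ := exists_leading_skew hn
    have hb0 : b = 0 := by
      refine eq_zero_of_pow_mul_mem_skewDegreeLT hfree (n := m + n) ?_
      have := sub_mem (sub_mem (skewDegreeLT_mono (by omega : m ≤ m + n) hs) (mul_mem n _ hb))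
        (lower n b)
      convert this using 1
      noncomm_ring
    exact ih (by simpa [hb0] using hb)

/-- A monic polynomial generating a two-sided ideal commutes with the coefficients and has
coefficients annihilated by the derivation. -/
theorem monic_twoSided_commute
    (hD : ∀ α β : B, D (α * β) = D α * β + α * D β)
    (hcomm : ∀ α : B, ι α * X = X * ι α + ι (D α))
    (hfree : ∀ r : R, ∃! c : ℕ →₀ B, r = c.sum fun i b => X ^ i * ι b)
    {m : ℕ} {a : ℕ → B} (ham : a m = 1)
    {f : R} (hf : f = ∑ i ∈ range (m + 1), X ^ i * ι (a i))
    (htwo : (Set.range fun r => f * r) = Set.range fun r => r * f) :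
    (∀ α, ι α * f = f * ι α) ∧ ∀ i < m + 1, D (a i) = 0 := by
  have hD1 : D 1 = 0 := by simpa using hD 1 1
  have hmonic : f - X ^ m ∈ skewDegreeLT ι X m := by
    rw [hf, sum_range_succ, ham, map_one, mul_one, add_sub_cancel_right]
    exact sum_mem fun i hi => pow_mul_mem_skewDegreeLT (mem_range.1 hi) _
  have hcommute : ∀ r, r * f - f * r ∈ skewDegreeLT ι X m → r * f = f * r := fun r hr => by
    have : r * f ∈ Set.range fun r => f * r := htwo ▸ ⟨r, rfl⟩
    obtain ⟨s, hs⟩ := this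
    have hs : f * s = r * f := hs
    rw [← hs, ← mul_sub] at hr
    have := monic_mul_eq_zero hcomm hfree hmonic hr
    rw [mul_sub, hs, sub_eq_zero] at this
    exact this
  constructor
  · refine fun α => hcommute _ ?_
    have hlow : ∀ g ∈ skewDegreeLT ι X m, ι α * g ∈ skewDegreeLT ι X m := fun g hg => by
      refine map_mem_of_mem_skewDegreeLT (AddMonoidHom.mulLeft (ι α)) _ (fun i hi c => ?_) hg
      have := add_mem (skewDegreeLT_mono hi.le
        (mul_coeff_mem_skewDegreeLT (commutator_pow_mem_skewDegreeLT hcomm α i) c))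
        (pow_mul_mem_skewDegreeLT (ι := ι) (X := X) hi (α * c))
      convert this using 1
      simp only [AddMonoidHom.coe_mulLeft, map_mul]
      noncomm_ring
    have := add_mem (commutator_pow_mem_skewDegreeLT hcomm α m)
      (sub_mem (hlow _ hmonic) (mul_coeff_mem_skewDegreeLT hmonic α))
    convert this using 1
    noncomm_ring
  · have key : f * X - X * f = ∑ i ∈ range (m + 1), X ^ i * ι (D (a i)) := by
      rw [hf, sum_mul, mul_sum, ← sum_sub_distrib]
      refine sum_congr rfl fun i _ => ?_
      rw [mul_assoc, hcomm, mul_add, ← mul_assoc, ← mul_assoc, ← pow_succ, ← pow_succ',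
        add_sub_cancel_left]
    have hX : X * f = f * X := by
      refine hcommute _ ?_
      rw [← neg_sub, key, sum_range_succ, ham, hD1]
      simp only [map_zero, mul_zero, add_zero]
      exact neg_mem (sum_mem fun i hi => pow_mul_mem_skewDegreeLT (mem_range.1 hi) _)
    intro i hi
    obtain ⟨δ, hδ⟩ := exists_coeff_skew hfree i
    have := congrArg δ key
    rw [hX, sub_self, map_zero, map_sum] at this
    simp only [hδ, sum_ite_eq', mem_range, hi, if_true] at this
    exact this.symm

/-- The derivation sending `X` to an element centralizing the coefficients is left linear. -/
theorem powDeriv_sum_commute {A : Type*} [Ring A]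
    (hcomm : ∀ α : B, ι α * X = X * ι α + ι (D α))
    (hfree : ∀ r : R, ∃! c : ℕ →₀ B, r = c.sum fun i b => X ^ i * ι b)
    (π : R →+* A) {v : A} (hv : ∀ α : B, π (ι α) * v = v * π (ι α))
    {n : ℕ} {a : ℕ → B} {f : R} (hf : f = ∑ i ∈ range n, X ^ i * ι (a i)) {α : B}
    (hα : ι α * f = f * ι α) :
    π (ι α) * (∑ i ∈ range n, powDeriv (π X) v i * π (ι (a i))) =
      (∑ i ∈ range n, powDeriv (π X) v i * π (ι (a i))) * π (ι α) := by
  obtain ⟨δ, hδ⟩ := exists_addMonoidHom_skew hfree fun i =>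
    (AddMonoidHom.mulLeft (powDeriv (π X) v i)).comp (π.comp ι).toAddMonoidHom
  replace hδ : ∀ i b, δ (X ^ i * ι b) = powDeriv (π X) v i * π (ι b) := hδ
  have induct : ∀ {P : R → Prop}, P 0 → (∀ r s, P r → P s → P (r + s)) →
      (∀ i b, P (X ^ i * ι b)) → ∀ r, P r := fun {P} h0 hadd hmon r => by
    obtain ⟨c, rfl, -⟩ := hfree r
    exact sum_induction _ P hadd h0 fun i _ => hmon i _
  have hright : ∀ b r, δ (r * ι b) = δ r * π (ι b) := fun b => by
    refine induct (by simp) (fun r s hr hs => by simp [add_mul, hr, hs]) fun i c => ?_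
    rw [mul_assoc, ← map_mul, hδ, hδ, map_mul, map_mul, mul_assoc]
  have hX : ∀ r, δ (X * r) = π X * δ r + v * π r := by
    refine induct (by simp) (fun r s hr hs => ?_) fun i c => ?_
    · simp only [mul_add, map_add, hr, hs]; abel
    · rw [← mul_assoc, ← pow_succ', hδ, hδ, powDeriv_succ, map_mul, map_pow]
      noncomm_ring
  have hpow : ∀ i (β : B), δ (ι β * X ^ i) = π (ι β) * powDeriv (π X) v i := fun i => by
    induction i with
    | zero =>
      intro β
      have := hδ 0 β
      simp only [pow_zero, one_mul] at this
      simp [this, powDeriv]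
    | succ i ih =>
      intro β
      have h : π (ι β) * π X = π X * π (ι β) + π (ι (D β)) := by
        rw [← map_mul, hcomm, map_add, map_mul]
      rw [pow_succ', ← mul_assoc, hcomm, add_mul, mul_assoc, map_add, hX, ih, ih, map_mul, map_pow,
        powDeriv_succ, mul_add, ← mul_assoc (π (ι β)) (π X), h, ← mul_assoc (π (ι β)) v, hv]
      noncomm_ring
  have hleft : δ (ι α * f) = π (ι α) * ∑ i ∈ range n, powDeriv (π X) v i * π (ι (a i)) := by
    rw [hf, mul_sum, map_sum, mul_sum]
    refine sum_congr rfl fun i _ => ?_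
    rw [← mul_assoc, hright, hpow, mul_assoc]
  rw [← hleft, hα, hright, hf, map_sum]
  simp only [hδ]

end SkewPolynomial

/-- In the derivation-type case `R = B[X;D]` (`ρ = id`), for any monic
`f = Σ_{i=0}^{m} X^i a_i` of degree `m ≥ 1` with `fR = Rf`, with `A = R/fR`,
`x = X + fR`, `y_j = Σ_{k=j}^{m−1} x^{k−j} a_{k+1}` and `τ(z) = Σ_{j=0}^{m−1} y_j z x^j`:
the map `τ` carries the centralizer `V` of `B` in `A` into the center `C(A)` of `A`;
that is, `τ(V) ⊆ C(A)`. -/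
theorem stmt14 {B R A : Type*} [Ring B] [Ring R] [Ring A]
    (ι : B →+* R) (hι : Function.Injective ι) (X : R)
    (D : B →+ B)
    (hD : ∀ α β : B, D (α * β) = D α * β + α * D β)
    (hcomm : ∀ α : B, ι α * X = X * ι α + ι (D α))
    (hfree : ∀ r : R, ∃! c : ℕ →₀ B, r = c.sum fun i b => X ^ i * ι b)
    (m : ℕ) (hm : 1 ≤ m) (a : ℕ → B) (ham : a m = 1)
    (f : R) (hf : f = ∑ i ∈ Finset.range (m + 1), X ^ i * ι (a i))
    (htwo : (Set.range fun r => f * r) = Set.range fun r => r * f)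
    (π : R →+* A) (hπ : Function.Surjective π)
    (hker : ∀ r : R, π r = 0 ↔ ∃ s, r = f * s)
    (y : ℕ → A)
    (hy : ∀ j, y j = ∑ k ∈ Finset.Icc j (m - 1), π X ^ (k - j) * π (ι (a (k + 1))))
    (τ : A → A)
    (hτ : ∀ z, τ z = ∑ j ∈ Finset.range m, y j * z * π X ^ j) :
    ∀ v : A, (∀ α : B, π (ι α) * v = v * π (ι α)) → ∀ w : A, τ v * w = w * τ v := by
  intro v hv
  obtain ⟨hα, hDa⟩ := monic_twoSided_commute hD hcomm hfree ham hf htwo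
  have hax : ∀ i < m + 1, Commute (π (ι (a i))) (π X) := fun i hi => by
    have := congrArg π (hcomm (a i))
    simpa [hDa i hi, commute_iff_eq] using this
  have hτv : τ v = ∑ i ∈ Finset.range (m + 1), powDeriv (π X) v i * π (ι (a i)) := by
    rw [hτ, Finset.sum_range_succ']
    simp only [hy, powDeriv, Finset.sum_mul, Finset.range_zero, Finset.sum_empty, zero_mul,
      add_zero, Nat.add_sub_cancel]
    rw [Finset.sum_comm' (t' := Finset.range m) (s' := fun k => Finset.range (k + 1))
      (by intro j k; simp only [Finset.mem_range, Finset.mem_Icc]; omega)]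
    refine Finset.sum_congr rfl fun k hk => Finset.sum_congr rfl fun j _ => ?_
    have hk := Finset.mem_range.1 hk
    rw [mul_assoc (π X ^ (k - j)), hv, mul_assoc, mul_assoc, mul_assoc, mul_assoc,
      ((hax (k + 1) (by omega)).pow_right j).eq]
  have hf0 : ∑ i ∈ Finset.range (m + 1), π X ^ i * π (ι (a i)) = 0 := by
    have := (hker f).2 ⟨1, (mul_one f).symm⟩
    simpa [hf] using this
  have hτα : ∀ α, Commute (τ v) (π (ι α)) := fun α => by
    rw [hτv]
    exact (powDeriv_sum_commute hcomm hfree π hv hf (hα α)).symm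
  have hτX : Commute (τ v) (π X) := by
    have hl : ∑ i ∈ Finset.range (m + 1), powDeriv (π X) v (i + 1) * π (ι (a i)) =
        π X * τ v := by
      rw [hτv, Finset.mul_sum, ← add_zero (∑ i ∈ _, π X * _), ← mul_zero v, ← hf0, Finset.mul_sum,
        ← Finset.sum_add_distrib]
      refine Finset.sum_congr rfl fun i _ => ?_
      rw [powDeriv_succ]
      noncomm_ring
    have hr : ∑ i ∈ Finset.range (m + 1), powDeriv (π X) v (i + 1) * π (ι (a i)) =
        τ v * π X := by
      rw [hτv, Finset.sum_mul, ← add_zero (∑ i ∈ _, _ * _ * π X), ← zero_mul v, ← hf0, Finset.sum_mul,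
        ← Finset.sum_add_distrib]
      refine Finset.sum_congr rfl fun i hi => ?_
      rw [powDeriv_succ_right, add_mul, mul_assoc _ (π X), mul_assoc _ v, mul_assoc _ _ v,
        mul_assoc _ _ (π X), hv, (hax i (Finset.mem_range.1 hi)).eq]
    exact hr.symm.trans hl
  intro w
  obtain ⟨r, rfl⟩ := hπ w
  obtain ⟨c, rfl, -⟩ := hfree r
  rw [Finsupp.sum, map_sum]
  refine Commute.sum_right _ _ _ fun i _ => ?_
  rw [map_mul, map_pow]
  exact (hτX.pow_right i).mul_right (hτα _)
end

section
/- In the derivation-type case R = B[X;D] (ρ = id), a monic polynomial f = Σ_{i=0}^{m} X^i a_i of degree m ≥ 1 with fR = Rf is weakly separable in R (every B-derivation of A = R/fR is inner) if and only if the sequence V → V → C(A), given by I_x followed by τ, is exact at the middle term; that is, if and only if {v ∈ V : τ(v) = 0} = I_x(V). -/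
open Finset

/-- `R` is the skew polynomial ring `B[X;D]`: the powers of `X` form a basis of `R` as a right
`B`-module, and `α X = X α + D α`. -/
structure IsSkewPoly {B R : Type*} [Ring B] [Ring R] (ι : B →+* R) (X : R) (D : B →+ B) :
    Prop where
  comm : ∀ α : B, ι α * X = X * ι α + ι (D α)
  free : ∀ r : R, ∃! c : ℕ →₀ B, r = c.sum fun i b => X ^ i * ι b

namespace IsSkewPoly

/-- The additive map sending a finitely supported family `c` to `∑ Y i * φ (c i)`. -/
noncomputable def ofCoeff {B S : Type*} [Ring B] [Ring S] (φ : B →+* S) (Y : ℕ → S) :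
    (ℕ →₀ B) →+ S :=
  Finsupp.liftAddHom fun i => (AddMonoidHom.mulLeft (Y i)).comp φ.toAddMonoidHom

theorem ofCoeff_single {B S : Type*} [Ring B] [Ring S] (φ : B →+* S) (Y : ℕ → S) (i : ℕ) (b : B) :
    ofCoeff φ Y (Finsupp.single i b) = Y i * φ b := by
  simp [ofCoeff]

variable {B R A : Type*} [Ring B] [Ring R] [Ring A] {ι : B →+* R} {X : R} {D : B →+ B}

theorem ofCoeff_bijective (h : IsSkewPoly ι X D) :
    Function.Bijective (ofCoeff ι fun i => X ^ i) := by
  rw [Function.bijective_iff_existsUnique]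
  intro r
  obtain ⟨c, hc, hu⟩ := h.free r
  exact ⟨c, hc.symm, fun d hd => hu d hd.symm⟩

/-- The coefficients of a skew polynomial. -/
noncomputable def coeff (h : IsSkewPoly ι X D) : R ≃+ (ℕ →₀ B) :=
  (AddEquiv.ofBijective _ h.ofCoeff_bijective).symm

theorem coeff_monomial (h : IsSkewPoly ι X D) (i : ℕ) (b : B) :
    h.coeff (X ^ i * ι b) = Finsupp.single i b := by
  rw [coeff, AddEquiv.symm_apply_eq]
  exact (ofCoeff_single ι _ i b).symm

theorem sum_coeff (h : IsSkewPoly ι X D) (r : R) :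
    ((h.coeff r).sum fun i b => X ^ i * ι b) = r :=
  h.coeff.symm_apply_apply r

theorem induction_monomial (h : IsSkewPoly ι X D) {P : R → Prop} (r : R) (zero : P 0)
    (add : ∀ r s, P r → P s → P (r + s)) (monomial : ∀ i b, P (X ^ i * ι b)) : P r := by
  rw [← h.sum_coeff r]
  exact Finset.sum_induction _ P add zero fun i _ => monomial i _

theorem induction_generators (h : IsSkewPoly ι X D) {P : R → Prop} (r : R) (zero : P 0)
    (one : P 1) (add : ∀ r s, P r → P s → P (r + s)) (mul_X : ∀ r, P r → P (r * X))
    (mul_C : ∀ r b, P r → P (r * ι b)) : P r := by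
  refine h.induction_monomial r zero add fun i b => mul_C _ b ?_
  induction i with
  | zero => simpa using one
  | succ i ih => rw [pow_succ]; exact mul_X _ ih

theorem coeff_mul_C (h : IsSkewPoly ι X D) (r : R) (b : B) (i : ℕ) :
    h.coeff (r * ι b) i = h.coeff r i * b := by
  induction r using h.induction_monomial with
  | zero => simp
  | add r s hr hs => simp [add_mul, hr, hs]
  | monomial j c =>
    rw [mul_assoc, ← map_mul, coeff_monomial, coeff_monomial]
    by_cases hij : j = i <;> simp [hij]

theorem coeff_X_mul_succ (h : IsSkewPoly ι X D) (r : R) (i : ℕ) :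
    h.coeff (X * r) (i + 1) = h.coeff r i := by
  induction r using h.induction_monomial with
  | zero => simp
  | add r s hr hs => simp [mul_add, hr, hs]
  | monomial j c =>
    rw [← mul_assoc, ← pow_succ', coeff_monomial, coeff_monomial]
    simp [Finsupp.single_apply]

theorem coeff_commutator_X (h : IsSkewPoly ι X D) (r : R) (i : ℕ) :
    h.coeff (r * X - X * r) i = D (h.coeff r i) := by
  induction r using h.induction_monomial with
  | zero => simp
  | add r s hr hs =>
    rw [add_mul, mul_add, add_sub_add_comm, map_add, map_add, Finsupp.add_apply, hr, hs,
      Finsupp.add_apply, map_add]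
  | monomial j c =>
    have : X ^ j * ι c * X - X * (X ^ j * ι c) = X ^ j * ι (D c) := by
      rw [mul_assoc, h.comm, mul_add, ← mul_assoc, ← mul_assoc, ← pow_succ, ← pow_succ']
      abel
    rw [this, coeff_monomial, coeff_monomial]
    by_cases hij : j = i <;> simp [hij]

theorem coeff_mul_X_succ (h : IsSkewPoly ι X D) (r : R) (i : ℕ) :
    h.coeff (r * X) (i + 1) = h.coeff r i + D (h.coeff r (i + 1)) := by
  rw [← h.coeff_commutator_X, ← h.coeff_X_mul_succ r, ← Finsupp.add_apply, ← map_add]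
  congr 2
  abel

theorem coeff_sum_range (h : IsSkewPoly ι X D) (a : ℕ → B) (n i : ℕ) :
    h.coeff (∑ j ∈ range n, X ^ j * ι (a j)) i = if i < n then a i else 0 := by
  simp [map_sum, coeff_monomial, Finsupp.finsetSum_apply, Finsupp.single_apply]

/-- A skew polynomial is monic of degree `m`. -/
def IsMonicOfDegree (h : IsSkewPoly ι X D) (r : R) (m : ℕ) : Prop :=
  ∀ i, m ≤ i → h.coeff r i = if i = m then 1 else 0

theorem map_one_eq_zero (h : IsSkewPoly ι X D) : D 1 = 0 := by
  have h1 := h.coeff_commutator_X 1 0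
  have h2 := h.coeff_monomial 0 1
  simp only [pow_zero, map_one, one_mul] at h2
  simpa [h2] using h1.symm

theorem IsMonicOfDegree.mul_X_pow {h : IsSkewPoly ι X D} {r : R} {m : ℕ}
    (hr : h.IsMonicOfDegree r m) (n : ℕ) : h.IsMonicOfDegree (r * X ^ n) (m + n) := by
  induction n with
  | zero => simpa using hr
  | succ n ih =>
    rintro (_ | i) hi
    · omega
    · rw [pow_succ, ← mul_assoc, coeff_mul_X_succ, ih i (by omega), ih (i + 1) (by omega),
        if_neg (by omega : i + 1 ≠ m + n), map_zero, add_zero]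
      simp [← add_assoc]

theorem IsMonicOfDegree.eq_zero_of_mul {h : IsSkewPoly ι X D} {r s : R} {m : ℕ}
    (hr : h.IsMonicOfDegree r m) (hrs : ∀ i, m ≤ i → h.coeff (r * s) i = 0) : s = 0 := by
  by_contra hs
  have hne : (h.coeff s).support.Nonempty := by
    rw [Finsupp.support_nonempty_iff]
    exact fun h0 => hs (h.coeff.map_eq_zero_iff.mp h0)
  set N := (h.coeff s).support.max' hne with hN
  have hmem : N ∈ (h.coeff s).support := Finset.max'_mem _ _
  have key : h.coeff (r * s) (m + N) = h.coeff s N := by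
    conv_lhs => rw [← h.sum_coeff s]
    rw [Finsupp.sum, Finset.mul_sum, map_sum, Finsupp.finsetSum_apply, Finset.sum_eq_single N]
    · rw [← mul_assoc, coeff_mul_C, hr.mul_X_pow N _ le_rfl, if_pos rfl, one_mul]
    · intro n hn hnN
      have hle : n ≤ N := Finset.le_max' _ _ hn
      rw [← mul_assoc, coeff_mul_C, hr.mul_X_pow n _ (by omega), if_neg (by omega), zero_mul]
    · exact fun hn => absurd hmem hn
  exact Finsupp.mem_support_iff.mp hmem (key ▸ hrs _ (by omega))

/-- A monic generator of a two-sided ideal has coefficients that are constants for `D`. -/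
theorem IsMonicOfDegree.map_coeff_eq_zero {h : IsSkewPoly ι X D} {f : R} {m : ℕ}
    (hf : h.IsMonicOfDegree f m) (htwo : ∃ s, X * f = f * s) (i : ℕ) : D (h.coeff f i) = 0 := by
  obtain ⟨s, hs⟩ := htwo
  have hfac : f * X - X * f = f * (X - s) := by rw [mul_sub, hs]
  have hzero : X - s = 0 := by
    refine hf.eq_zero_of_mul fun j hj => ?_
    rw [← hfac, coeff_commutator_X, hf j hj]
    split_ifs
    · exact h.map_one_eq_zero
    · exact map_zero D
  rw [← coeff_commutator_X, hfac, hzero, mul_zero, map_zero, Finsupp.zero_apply]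

theorem commute_X_of_map_eq_zero (h : IsSkewPoly ι X D) {b : B} (hb : D b = 0) :
    Commute (ι b) X := by
  have := h.comm b
  rwa [hb, map_zero, add_zero] at this

/-- An element commuting with the image of `B` is the value at `X` of a `B`-derivation. -/
theorem exists_derivation (h : IsSkewPoly ι X D) (π : R →+* A) {v : A}
    (hv : ∀ α, π (ι α) * v = v * π (ι α)) :
    ∃ Δ : R →+ A, (∀ r s, Δ (r * s) = Δ r * π s + π r * Δ s) ∧ (∀ β, Δ (ι β) = 0) ∧ Δ X = v := by
  let d : ℕ → A := fun i => ∑ k ∈ range i, π X ^ k * v * π X ^ (i - 1 - k)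
  have d_succ : ∀ i, d (i + 1) = d i * π X + π X ^ i * v := by
    intro i
    simp only [d, Finset.sum_range_succ, Finset.sum_mul]
    congr 1
    · refine Finset.sum_congr rfl fun k hk => ?_
      have := Finset.mem_range.mp hk
      rw [mul_assoc _ _ (π X), ← pow_succ]
      congr 2
      omega
    · simp
  let Δ : R →+ A := (ofCoeff (π.comp ι) d).comp h.coeff.toAddMonoidHom
  have Δ_monomial : ∀ i b, Δ (X ^ i * ι b) = d i * π (ι b) := by
    intro i b
    change ofCoeff (π.comp ι) d (h.coeff (X ^ i * ι b)) = _
    rw [coeff_monomial, ofCoeff_single, RingHom.comp_apply]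
  have Δ_C : ∀ β, Δ (ι β) = 0 := by
    intro β
    simpa [d] using Δ_monomial 0 β
  have Δ_X : Δ X = v := by simpa [d] using Δ_monomial 1 1
  have Δ_mul_C : ∀ r b, Δ (r * ι b) = Δ r * π (ι b) := by
    intro r b
    induction r using h.induction_monomial with
    | zero => simp
    | add r s hr hs => simp [add_mul, hr, hs]
    | monomial i c => rw [mul_assoc, ← map_mul, Δ_monomial, Δ_monomial, map_mul, map_mul, mul_assoc]
  have Δ_mul_X : ∀ r, Δ (r * X) = Δ r * π X + π r * v := by
    intro r
    induction r using h.induction_monomial with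
    | zero => simp
    | add r s hr hs => rw [add_mul, map_add, hr, hs, map_add, map_add]; noncomm_ring
    | monomial i c =>
      have hc : π (ι c) * π X = π X * π (ι c) + π (ι (D c)) := by
        rw [← map_mul, h.comm, map_add, map_mul]
      rw [mul_assoc, h.comm, mul_add, ← mul_assoc, ← pow_succ, map_add, Δ_monomial, Δ_monomial,
        Δ_monomial, d_succ, mul_assoc (d i), hc, map_mul, mul_assoc _ _ v, hv, map_pow]
      noncomm_ring
  refine ⟨Δ, fun r s => ?_, Δ_C, Δ_X⟩
  induction s using h.induction_generators with
  | zero => simp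
  | one => simp [show Δ 1 = 0 by simpa using Δ_C 1]
  | add s t hs ht => rw [mul_add, map_add, hs, ht, map_add, map_add]; noncomm_ring
  | mul_X s hs => rw [← mul_assoc, Δ_mul_X, Δ_mul_X, hs, map_mul, map_mul]; noncomm_ring
  | mul_C s b hs => rw [← mul_assoc, Δ_mul_C, Δ_mul_C, hs, map_mul]; noncomm_ring

/-- The value at `X` of a `B`-derivation commutes with the image of `B`. -/
theorem commute_derivation_X (h : IsSkewPoly ι X D) (π : R →+* A) (Δ : R →+ A)
    (hΔ : ∀ r s, Δ (r * s) = Δ r * π s + π r * Δ s) (hΔB : ∀ β, Δ (ι β) = 0) (α : B) :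
    π (ι α) * Δ X = Δ X * π (ι α) := by
  have := congrArg Δ (h.comm α)
  simpa [hΔ, hΔB] using this

/-- A `B`-derivation vanishing at `X` is zero. -/
theorem derivation_eq_zero (h : IsSkewPoly ι X D) (π : R →+* A) (Δ : R →+ A)
    (hΔ : ∀ r s, Δ (r * s) = Δ r * π s + π r * Δ s) (hΔB : ∀ β, Δ (ι β) = 0) (hΔX : Δ X = 0)
    (r : R) : Δ r = 0 := by
  induction r using h.induction_generators with
  | zero => simp
  | one => simpa using hΔB 1
  | add r s hr hs => rw [map_add, hr, hs, add_zero]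
  | mul_X r hr => rw [hΔ, hr, hΔX, zero_mul, mul_zero, add_zero]
  | mul_C r b hr => rw [hΔ, hr, hΔB, zero_mul, mul_zero, add_zero]

end IsSkewPoly

theorem derivation_pow {R A : Type*} [Ring R] [Ring A] (π : R →+* A) (Δ : R →+ A)
    (hΔ : ∀ r s, Δ (r * s) = Δ r * π s + π r * Δ s) (X : R) (n : ℕ) :
    Δ (X ^ (n + 1)) = ∑ j ∈ range (n + 1), π X ^ (n - j) * Δ X * π X ^ j := by
  induction n with
  | zero => simp
  | succ n ih =>
    rw [pow_succ', hΔ, ih, Finset.sum_range_succ _ (n + 1), Finset.mul_sum, add_comm]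
    congr 1
    · refine Finset.sum_congr rfl fun j hj => ?_
      have := Finset.mem_range.mp hj
      rw [Nat.succ_sub (by omega : j ≤ n), pow_succ']
      noncomm_ring
    · simp

/-- If the coefficients of `f` commute with `X`, then a `B`-derivation maps `f` to `τ` of its value
at `X`. -/
theorem derivation_apply_eq_trace {B R A : Type*} [Ring B] [Ring R] [Ring A] (ι : B →+* R) (X : R)
    (π : R →+* A) (Δ : R →+ A) (hΔ : ∀ r s, Δ (r * s) = Δ r * π s + π r * Δ s)
    (hΔB : ∀ β, Δ (ι β) = 0) (hΔX : ∀ α, π (ι α) * Δ X = Δ X * π (ι α)) (m : ℕ) (a : ℕ → B)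
    (ha : ∀ i ≤ m, Commute (ι (a i)) X) :
    Δ (∑ i ∈ range (m + 1), X ^ i * ι (a i)) =
      ∑ j ∈ range m, (∑ k ∈ Icc j (m - 1), π X ^ (k - j) * π (ι (a (k + 1)))) * Δ X * π X ^ j := by
  have hterm : ∀ k ∈ range m, Δ (X ^ (k + 1) * ι (a (k + 1))) =
      ∑ j ∈ range (k + 1), π X ^ (k - j) * π (ι (a (k + 1))) * Δ X * π X ^ j := by
    intro k hk
    rw [hΔ, hΔB, mul_zero, add_zero, derivation_pow π Δ hΔ, Finset.sum_mul]
    refine Finset.sum_congr rfl fun j _ => ?_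
    have hc : π X ^ j * π (ι (a (k + 1))) = π (ι (a (k + 1))) * π X ^ j := by
      have hak := (ha (k + 1) (by have := Finset.mem_range.mp hk; omega)).map π
      exact (hak.pow_right j).symm
    rw [mul_assoc, hc, ← mul_assoc, mul_assoc _ (Δ X), ← hΔX, ← mul_assoc]
  rw [Finset.sum_range_succ', map_add, map_sum, Finset.sum_congr rfl hterm]
  simp only [pow_zero, one_mul, hΔB, add_zero, Finset.sum_mul]
  refine Finset.sum_comm' fun k j => ?_
  simp only [Finset.mem_range, Finset.mem_Icc]
  omega

/-- In the derivation-type case `R = B[X;D]` (`ρ = id`), a monic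
`f = Σ_{i=0}^{m} X^i a_i` of degree `m ≥ 1` with `fR = Rf` is weakly separable in `R`
(every `B`-derivation of `A = R/fR` is inner) if and only if the sequence
`V → V → C(A)` given by `I_x` followed by `τ` is exact at the middle term; that is,
if and only if `{v ∈ V : τ(v) = 0} = I_x(V)`. -/
theorem stmt15 {B R A : Type*} [Ring B] [Ring R] [Ring A]
    (ι : B →+* R) (hι : Function.Injective ι) (X : R)
    (D : B →+ B)
    (hD : ∀ α β : B, D (α * β) = D α * β + α * D β)
    (hcomm : ∀ α : B, ι α * X = X * ι α + ι (D α))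
    (hfree : ∀ r : R, ∃! c : ℕ →₀ B, r = c.sum fun i b => X ^ i * ι b)
    (m : ℕ) (hm : 1 ≤ m) (a : ℕ → B) (ham : a m = 1)
    (f : R) (hf : f = ∑ i ∈ Finset.range (m + 1), X ^ i * ι (a i))
    (htwo : (Set.range fun r => f * r) = Set.range fun r => r * f)
    (π : R →+* A) (hπ : Function.Surjective π)
    (hker : ∀ r : R, π r = 0 ↔ ∃ s, r = f * s)
    (y : ℕ → A)
    (hy : ∀ j, y j = ∑ k ∈ Finset.Icc j (m - 1), π X ^ (k - j) * π (ι (a (k + 1))))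
    (τ : A → A)
    (hτ : ∀ z, τ z = ∑ j ∈ Finset.range m, y j * z * π X ^ j) :
    (∀ δ : A → A, (∀ z w : A, δ (z + w) = δ z + δ w) →
        (∀ z w : A, δ (z * w) = δ z * w + z * δ w) →
        (∀ β : B, δ (π (ι β)) = 0) →
        ∃ v : A, ∀ z : A, δ z = v * z - z * v) ↔
      {v : A | (∀ α : B, π (ι α) * v = v * π (ι α)) ∧ τ v = 0} =
        (fun v => v * π X - π X * v) '' {v : A | ∀ α : B, π (ι α) * v = v * π (ι α)} := by
  have h : IsSkewPoly ι X D := ⟨hcomm, hfree⟩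
  have coeff_f : ∀ i, h.coeff f i = if i < m + 1 then a i else 0 := by
    rw [hf]
    exact h.coeff_sum_range a (m + 1)
  have monic_f : h.IsMonicOfDegree f m := by
    intro i hi
    rw [coeff_f]
    rcases hi.eq_or_lt with rfl | hlt
    · simp [ham]
    · rw [if_neg (by omega), if_neg (by omega)]
  have hXf : ∃ s, X * f = f * s := by
    have : X * f ∈ Set.range fun r => f * r := htwo ▸ ⟨X, rfl⟩
    obtain ⟨s, hs⟩ := this
    exact ⟨s, hs.symm⟩
  have ha : ∀ i ≤ m, Commute (ι (a i)) X := by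
    intro i hi
    have := monic_f.map_coeff_eq_zero hXf i
    rw [coeff_f, if_pos (by omega)] at this
    exact h.commute_X_of_map_eq_zero this
  have πf : π f = 0 := (hker f).mpr ⟨1, (mul_one f).symm⟩
  have trace_eq : ∀ Δ : R →+ A, (∀ r s, Δ (r * s) = Δ r * π s + π r * Δ s) →
      (∀ β, Δ (ι β) = 0) → Δ f = τ (Δ X) := by
    intro Δ hΔ hΔB
    rw [hτ, hf, derivation_apply_eq_trace ι X π Δ hΔ hΔB (h.commute_derivation_X π Δ hΔ hΔB) m a ha]
    simp only [hy]
  have value_mem : ∀ δ : A →+ A, (∀ z w, δ (z * w) = δ z * w + z * δ w) →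
      (∀ β, δ (π (ι β)) = 0) →
      (∀ α, π (ι α) * δ (π X) = δ (π X) * π (ι α)) ∧ τ (δ (π X)) = 0 := by
    intro δ hδ hδB
    have hΔ : ∀ r s, (δ.comp π.toAddMonoidHom) (r * s) =
        (δ.comp π.toAddMonoidHom) r * π s + π r * (δ.comp π.toAddMonoidHom) s := by
      intro r s
      simp [hδ]
    refine ⟨h.commute_derivation_X π _ hΔ hδB, ?_⟩
    have := trace_eq _ hΔ hδB
    simpa [πf] using this.symm
  let inner : A → A →+ A := fun u => AddMonoidHom.mulLeft u - AddMonoidHom.mulRight u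
  have inner_apply : ∀ u z, inner u z = u * z - z * u := fun _ _ => rfl
  have inner_mul : ∀ u z w, inner u (z * w) = inner u z * w + z * inner u w := by
    intro u z w
    simp only [inner_apply]
    noncomm_ring
  constructor
  · intro hinner
    ext v
    constructor
    · rintro ⟨hv, hτv⟩
      obtain ⟨Δ, hΔ, hΔB, hΔX⟩ := h.exists_derivation π hv
      have hΔf : Δ f = 0 := by rw [trace_eq Δ hΔ hΔB, hΔX, hτv]
      have hle : ∀ r s, π r = π s → Δ r = Δ s := by
        intro r s hrs
        obtain ⟨t, ht⟩ := (hker (r - s)).mp (by rw [map_sub, hrs, sub_self])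
        rw [← sub_eq_zero, ← map_sub, ht, hΔ, hΔf, πf, zero_mul, zero_mul, add_zero]
      let δ : A → A := fun z => Δ (Function.surjInv hπ z)
      have hδ : ∀ r, δ (π r) = Δ r := fun r => hle _ _ (Function.surjInv_eq hπ _)
      obtain ⟨u, hu⟩ := hinner δ
        (fun z w => by
          obtain ⟨r, rfl⟩ := hπ z
          obtain ⟨s, rfl⟩ := hπ w
          rw [← map_add, hδ, hδ, hδ, map_add])
        (fun z w => by
          obtain ⟨r, rfl⟩ := hπ z
          obtain ⟨s, rfl⟩ := hπ w
          rw [← map_mul, hδ, hδ, hδ, hΔ])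
        (fun β => by rw [hδ, hΔB])
      refine ⟨u, fun α => ?_, ?_⟩
      · have := hu (π (ι α))
        rw [hδ, hΔB] at this
        exact (sub_eq_zero.mp this.symm).symm
      · change u * π X - π X * u = v
        rw [← hu, hδ, hΔX]
    · rintro ⟨u, hu, rfl⟩
      refine value_mem (inner u) (inner_mul u) fun β => ?_
      rw [inner_apply, hu β, sub_self]
  · intro hexact δ hadd hmul hB
    let δ' : A →+ A := AddMonoidHom.mk' δ hadd
    have hmem := value_mem δ' hmul hB
    change δ (π X) ∈ {v : A | (∀ α : B, π (ι α) * v = v * π (ι α)) ∧ τ v = 0} at hmem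
    rw [hexact] at hmem
    obtain ⟨u, hu, hux⟩ := hmem
    refine ⟨u, fun z => ?_⟩
    obtain ⟨r, rfl⟩ := hπ z
    have := h.derivation_eq_zero π ((δ' - inner u).comp π.toAddMonoidHom)
      (fun r s => by
        change δ (π (r * s)) - inner u (π (r * s)) = (δ (π r) - inner u (π r)) * π s +
          π r * (δ (π s) - inner u (π s))
        rw [map_mul, hmul, inner_mul]
        noncomm_ring)
      (fun β => by
        change δ (π (ι β)) - (u * π (ι β) - π (ι β) * u) = 0
        rw [hB, hu β, sub_self, sub_self])
      (by
        change δ (π X) - (u * π X - π X * u) = 0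
        exact sub_eq_zero.mpr hux.symm) r
    exact sub_eq_zero.mp this
end
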